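/- arXiv:2004.09692 — 8 statements merged into one kernel-verified Lean document; each statement's English description precedes it below -/
import Mathlib

section
/- Let (X,S) be an association scheme, let x ∈ X, let K be a field of positive characteristic p, and suppose that p divides the valency n_s for some s ∈ S. Then the Terwilliger algebra KT(x) is not a semisimple ring. -/
open Matrix

/-- An association scheme on a finite set `X`: a partition `S` of `X × X` into nonempty
relations containing the diagonal, closed under transposition, with intersection numbers. -/
structure AssocScheme (X : Type*) [Fintype X] [DecidableEq X] where
  S : Finset (Finset (X × X))
  nonempty_mem : ∀ s ∈ S, s.Nonempty
  exists_unique_mem : ∀ p : X × X, ∃! s, s ∈ S ∧ p ∈ s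
  diag_mem : Finset.univ.filter (fun p : X × X => p.1 = p.2) ∈ S
  star_mem : ∀ s ∈ S, s.image (fun p : X × X => (p.2, p.1)) ∈ S
  pnum : Finset (X × X) → Finset (X × X) → Finset (X × X) → ℕ
  card_eq_pnum : ∀ s ∈ S, ∀ t ∈ S, ∀ u ∈ S, ∀ y z : X, (y, z) ∈ u →
      (Finset.univ.filter fun w => (y, w) ∈ s ∧ (w, z) ∈ t).card = pnum s t u

variable {X : Type*} [Fintype X] [DecidableEq X]

/-- The adjacency matrix `σ_s` of a relation `s ⊆ X × X`. -/
def adjMat (R : Type*) [Zero R] [One R] (s : Finset (X × X)) : Matrix X X R :=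
  Matrix.of fun y z => if (y, z) ∈ s then 1 else 0

/-- The diagonal idempotent `E_s*` at the base point `x`. -/
def dualIdem (R : Type*) [Zero R] [One R] (x : X) (s : Finset (X × X)) : Matrix X X R :=
  Matrix.diagonal fun y => if (x, y) ∈ s then 1 else 0

/-- The Terwilliger algebra `RT(x)`: the `R`-subalgebra of `M_X(R)` generated by
the matrices `E_s* σ_t E_u*` for `s, t, u ∈ S`. -/
def TerwAlg (R : Type*) [CommRing R] (A : AssocScheme X) (x : X) :
    Subalgebra R (Matrix X X R) :=
  Algebra.adjoin R {m | ∃ s ∈ A.S, ∃ t ∈ A.S, ∃ u ∈ A.S,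
    m = dualIdem R x s * adjMat R t * dualIdem R x u}

/-- In a semisimple ring, an element `v` with `v * a * v = 0` for all `a` vanishes. -/
theorem eq_zero_of_forall_mul_mul_eq_zero {R : Type*} [Ring R] [IsSemisimpleRing R] {v : R}
    (h : ∀ a, v * a * v = 0) : v = 0 := by
  obtain ⟨e, he, hspan⟩ := IsSemisimpleRing.ideal_eq_span_idempotent (Ideal.span {v})
  obtain ⟨a, ha⟩ := Ideal.mem_span_singleton'.1
    (hspan ▸ Ideal.mem_span_singleton_self e : e ∈ Ideal.span {v})
  obtain ⟨b, hb⟩ := Ideal.mem_span_singleton'.1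
    (hspan ▸ Ideal.mem_span_singleton_self v : v ∈ Ideal.span {e})
  have he0 : e = 0 := by
    rw [← he.eq, ← ha, mul_assoc, ← mul_assoc v, h, mul_zero]
  rw [← hb, he0, mul_zero]

namespace AssocScheme

/-- Two relations of a scheme sharing a pair coincide. -/
theorem eq_of_mem (A : AssocScheme X) {s t : Finset (X × X)} (hs : s ∈ A.S) (ht : t ∈ A.S)
    {q : X × X} (hqs : q ∈ s) (hqt : q ∈ t) : s = t :=
  (A.exists_unique_mem q).unique ⟨hs, hqs⟩ ⟨ht, hqt⟩

/-- Every relation of a scheme has an outgoing pair at each point. -/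
theorem exists_mem_of_mem (A : AssocScheme X) {s : Finset (X × X)} (hs : s ∈ A.S) (x : X) :
    ∃ z, (x, z) ∈ s := by
  obtain ⟨⟨y, w⟩, hyw⟩ := A.nonempty_mem s hs
  have hcard := (A.card_eq_pnum s hs _ (A.star_mem s hs) _ A.diag_mem y y (by simp)).trans
    (A.card_eq_pnum s hs _ (A.star_mem s hs) _ A.diag_mem x x (by simp)).symm
  have hpos : 0 < (Finset.univ.filter fun w =>
      (y, w) ∈ s ∧ (w, y) ∈ s.image fun q : X × X => (q.2, q.1)).card :=
    Finset.card_pos.2 ⟨w, by simpa using hyw⟩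
  rw [hcard] at hpos
  obtain ⟨z, hz⟩ := Finset.card_pos.1 hpos
  exact ⟨z, (Finset.mem_filter.1 hz).2.1⟩

/-- A function on the points is constant on every neighbourhood `xs`, `s ∈ S`. -/
def IsConstOnNeighbors {R : Type*} (A : AssocScheme X) (x : X) (f : X → R) : Prop :=
  ∀ s ∈ A.S, ∀ y z, (x, y) ∈ s → (x, z) ∈ s → f y = f z

theorem isConstOnNeighbors_single {R : Type*} [Zero R] (A : AssocScheme X) (x : X) (r : R) :
    A.IsConstOnNeighbors x (Pi.single x r : X → R) := by
  intro s hs y z hy hz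
  have key : y = x ↔ z = x := by
    constructor
    · rintro rfl
      have := A.eq_of_mem hs A.diag_mem hy (by simp)
      simpa [this, eq_comm] using hz
    · rintro rfl
      have := A.eq_of_mem hs A.diag_mem hz (by simp)
      simpa [this, eq_comm] using hy
  simp only [Pi.single_apply, key]

/-- The row vectors constant on neighbourhoods of `x` form a right module over the
Terwilliger algebra. -/
theorem IsConstOnNeighbors.vecMul {R : Type*} [CommRing R] {A : AssocScheme X} {x : X}
    {m : Matrix X X R} (hm : m ∈ TerwAlg R A x) {f : X → R} (hf : A.IsConstOnNeighbors x f) :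
    A.IsConstOnNeighbors x (f ᵥ* m) := by
  induction hm using Algebra.adjoin_induction generalizing f with
  | mem m hm =>
    obtain ⟨a, ha, t, ht, b, hb, rfl⟩ := hm
    obtain ⟨w, hw⟩ := A.exists_mem_of_mem ha x
    have entry (z : X) : (f ᵥ* (dualIdem R x a * adjMat R t * dualIdem R x b)) z =
        if (x, z) ∈ b then f w * (A.pnum a t b : R) else 0 := by
      simp only [Matrix.vecMul, dotProduct, dualIdem, Matrix.mul_diagonal,
        Matrix.diagonal_mul, adjMat, Matrix.of_apply]
      split_ifs with hz
      · rw [← A.card_eq_pnum a ha t ht b hb x z hz, Finset.card_filter, Nat.cast_sum,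
          Finset.mul_sum]
        refine Finset.sum_congr rfl fun y _ => ?_
        by_cases hy : (x, y) ∈ a
        · simp [hy, hf a ha y w hy hw]
        · simp [hy]
      · simp
    intro s hs y z hy hz
    have key : (x, y) ∈ b ↔ (x, z) ∈ b :=
      ⟨fun h => A.eq_of_mem hs hb hy h ▸ hz, fun h => A.eq_of_mem hs hb hz h ▸ hy⟩
    simp only [entry, key]
  | algebraMap r =>
    intro s hs y z hy hz
    simp [Algebra.algebraMap_eq_smul_one, Matrix.vecMul_smul, hf s hs y z hy hz]
  | add m n _ _ hm hn =>
    intro s hs y z hy hz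
    simp [Matrix.vecMul_add, hm hf s hs y z hy hz, hn hf s hs y z hy hz]
  | mul m n _ _ hm hn =>
    rw [← Matrix.vecMul_vecMul]
    exact hn (hm hf)

/-- The matrix whose column at `x` is the indicator of `xs`, and whose other columns vanish,
lies in the Terwilliger algebra. -/
theorem vecMulVec_mem_terwAlg (R : Type*) [CommRing R] (A : AssocScheme X) (x : X)
    {s : Finset (X × X)} (hs : s ∈ A.S) :
    Matrix.vecMulVec (fun y => if (x, y) ∈ s then (1 : R) else 0) (Pi.single x 1) ∈
      TerwAlg R A x := by
  refine Algebra.subset_adjoin ⟨s, hs, _, A.star_mem s hs, _, A.diag_mem, ?_⟩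
  ext y z
  by_cases hz : z = x
  · subst hz
    by_cases hy : (z, y) ∈ s <;>
      simp [Matrix.vecMulVec_apply, dualIdem, adjMat, hy]
  · simp [Matrix.vecMulVec_apply, dualIdem, hz, Ne.symm hz]

end AssocScheme

/-- **Theorem (non-semisimplicity).** If `K` is a field of positive characteristic `p`
and `p` divides the valency `n_s = |xs|` of some `s ∈ S`, then the Terwilliger algebra
`KT(x)` is not semisimple. -/
theorem terwAlg_not_isSemisimpleRing (A : AssocScheme X) (x : X)
    (K : Type*) [Field K] (p : ℕ) (hp : p ≠ 0) [CharP K p]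
    (s : Finset (X × X)) (hs : s ∈ A.S)
    (hdvd : p ∣ (Finset.univ.filter fun z => (x, z) ∈ s).card) :
    ¬ IsSemisimpleRing (TerwAlg K A x) := by
  intro hss
  let u : X → K := fun y => if (x, y) ∈ s then 1 else 0
  let v : TerwAlg K A x := ⟨Matrix.vecMulVec u (Pi.single x 1), A.vecMulVec_mem_terwAlg K x hs⟩
  obtain ⟨w, hw⟩ := A.exists_mem_of_mem hs x
  have hv : v = 0 := by
    refine eq_zero_of_forall_mul_mul_eq_zero fun a => Subtype.ext ?_
    have hconst := (A.isConstOnNeighbors_single x (1 : K)).vecMul a.2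
    have hdot : (Pi.single x 1 ᵥ* (a : Matrix X X K)) ⬝ᵥ u = 0 := by
      calc (Pi.single x 1 ᵥ* (a : Matrix X X K)) ⬝ᵥ u
          = ∑ y, (Pi.single x 1 ᵥ* (a : Matrix X X K)) w * (if (x, y) ∈ s then 1 else 0) := by
            refine Finset.sum_congr rfl fun y _ => ?_
            by_cases hy : (x, y) ∈ s
            · rw [hconst s hs y w hy hw]
            · simp [u, hy]
        _ = 0 := by
            rw [← Finset.mul_sum, Finset.sum_boole, (CharP.cast_eq_zero_iff K p _).2 hdvd,
              mul_zero]
    change Matrix.vecMulVec u (Pi.single x 1) * (a : Matrix X X K) *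
      Matrix.vecMulVec u (Pi.single x 1) = 0
    rw [Matrix.vecMulVec_mul, Matrix.vecMulVec_mul_vecMulVec, hdot]
    simp
  have hentry := congrFun (congrFun (congrArg Subtype.val hv) w) x
  simp [v, u, Matrix.vecMulVec_apply, hw] at hentry
end

section
/- Let (X,S) be an association scheme, x ∈ X, s ∈ S with xs ≠ ∅, and K a field. Let J ∈ M_X(K) denote the all-ones matrix. Then K·E_s* J E_s* is a one-dimensional two-sided ideal of the corner algebra E_s*(KT(x))E_s* := {E_s* a E_s* : a ∈ KT(x)}. -/
open Matrix

variable {X : Type*} [Fintype X] [DecidableEq X]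

/-- The indicator function of the fibre `xs`. -/
def fiberInd (R : Type*) [Zero R] [One R] (x : X) (s : Finset (X × X)) : X → R :=
  fun y => if (x, y) ∈ s then 1 else 0

/-- Functions that are constant on every fibre `xr`, `r ∈ S`. -/
def AssocScheme.FiberConst {R : Type*} (A : AssocScheme X) (x : X) (f : X → R) : Prop :=
  ∀ r ∈ A.S, ∀ y z, (x, y) ∈ r → (x, z) ∈ r → f y = f z

lemma AssocScheme.mem_iff_of_mem (A : AssocScheme X) {r s : Finset (X × X)} (hr : r ∈ A.S)
    (hs : s ∈ A.S) {p q : X × X} (hp : p ∈ r) (hq : q ∈ r) : p ∈ s ↔ q ∈ s := by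
  constructor
  · intro h
    rwa [(A.exists_unique_mem p).unique ⟨hs, h⟩ ⟨hr, hp⟩]
  · intro h
    rwa [(A.exists_unique_mem q).unique ⟨hs, h⟩ ⟨hr, hq⟩]

lemma AssocScheme.sum_ite_mem {R : Type*} [AddCommMonoid R] (A : AssocScheme X) (p : X × X)
    (a : R) : ∑ u ∈ A.S, (if p ∈ u then a else 0) = a := by
  obtain ⟨u, ⟨hu, hp⟩, huniq⟩ := A.exists_unique_mem p
  rw [Finset.sum_eq_single_of_mem u hu, if_pos hp]
  intro v hv hne
  exact if_neg fun h => hne (huniq v ⟨hv, h⟩)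

lemma AssocScheme.sum_adjMat {R : Type*} [Semiring R] (A : AssocScheme X) :
    ∑ t ∈ A.S, adjMat R t = Matrix.of fun _ _ => (1 : R) := by
  ext y z
  simp only [Matrix.sum_apply, adjMat, Matrix.of_apply]
  exact A.sum_ite_mem (y, z) 1

lemma AssocScheme.fiberConst_fiberInd {R : Type*} [Zero R] [One R] (A : AssocScheme X) (x : X)
    {s : Finset (X × X)} (hs : s ∈ A.S) : A.FiberConst x (fiberInd R x s) := by
  intro r hr y z hy hz
  simp only [fiberInd, A.mem_iff_of_mem hr hs hy hz]

lemma dualIdem_mul_self (R : Type*) [Semiring R] (x : X) (s : Finset (X × X)) :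
    dualIdem R x s * dualIdem R x s = dualIdem R x s := by
  simp +contextual [dualIdem, Matrix.diagonal_mul_diagonal]

lemma transpose_dualIdem {Y : Type*} [DecidableEq Y] (R : Type*) [Zero R] [One R] (x : Y)
    (s : Finset (Y × Y)) :
    (dualIdem R x s)ᵀ = dualIdem R x s :=
  Matrix.diagonal_transpose _

lemma transpose_adjMat {Y : Type*} [DecidableEq Y] (R : Type*) [Zero R] [One R]
    (t : Finset (Y × Y)) :
    (adjMat R t)ᵀ = adjMat R (t.image fun p : Y × Y => (p.2, p.1)) := by
  ext y z
  simp [adjMat]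

lemma dualIdem_mul_ones_mul_dualIdem (R : Type*) [Semiring R] (x : X) (s : Finset (X × X)) :
    dualIdem R x s * Matrix.of (fun _ _ => (1 : R)) * dualIdem R x s =
      vecMulVec (fiberInd R x s) (fiberInd R x s) := by
  ext y z
  simp [dualIdem, fiberInd, vecMulVec_apply]

lemma AssocScheme.FiberConst.vecMul_dualIdem {R : Type*} [Semiring R] {A : AssocScheme X} {x : X}
    {f : X → R} (hf : A.FiberConst x f) {s : Finset (X × X)} (hs : s ∈ A.S) :
    A.FiberConst x (f ᵥ* dualIdem R x s) := by
  intro r hr y z hy hz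
  simp only [dualIdem, Matrix.vecMul_diagonal, hf r hr y z hy hz, A.mem_iff_of_mem hr hs hy hz]

lemma AssocScheme.FiberConst.vecMul_adjMat {R : Type*} [Semiring R] {A : AssocScheme X} {x : X}
    {f : X → R} (hf : A.FiberConst x f) {t : Finset (X × X)} (ht : t ∈ A.S) :
    A.FiberConst x (f ᵥ* adjMat R t) := by
  have expand : ∀ y, (f ᵥ* adjMat R t) y =
      ∑ u ∈ A.S, ∑ w with (x, w) ∈ u ∧ (w, y) ∈ t, f w := by
    intro y
    have h : ∀ w, f w * adjMat R t w y =
        ∑ u ∈ A.S, if (x, w) ∈ u ∧ (w, y) ∈ t then f w else 0 := by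
      intro w
      simp only [ite_and, A.sum_ite_mem]
      simp [adjMat]
    simp only [Matrix.vecMul, dotProduct, h, Finset.sum_filter]
    exact Finset.sum_comm
  intro r hr y z hy hz
  rw [expand, expand]
  refine Finset.sum_congr rfl fun u hu => ?_
  by_cases hne : ∃ w₀, (x, w₀) ∈ u
  · obtain ⟨w₀, hw₀⟩ := hne
    have key : ∀ v, (x, v) ∈ r →
        ∑ w with (x, w) ∈ u ∧ (w, v) ∈ t, f w = A.pnum u t r • f w₀ := by
      intro v hv
      rw [← A.card_eq_pnum u hu t ht r hr x v hv]
      refine Finset.sum_eq_card_nsmul fun w hw => ?_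
      exact hf u hu w w₀ (Finset.mem_filter.mp hw).2.1 hw₀
    rw [key y hy, key z hz]
  · push Not at hne
    simp [hne]

lemma AssocScheme.FiberConst.vecMul {R : Type*} [CommRing R] {A : AssocScheme X} {x : X}
    {a : Matrix X X R} (ha : a ∈ TerwAlg R A x) :
    ∀ {f : X → R}, A.FiberConst x f → A.FiberConst x (f ᵥ* a) := by
  induction ha using Algebra.adjoin_induction with
  | mem m hm =>
    obtain ⟨s, hs, t, ht, u, hu, rfl⟩ := hm
    intro f hf
    rw [← Matrix.vecMul_vecMul, ← Matrix.vecMul_vecMul]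
    exact ((hf.vecMul_dualIdem hs).vecMul_adjMat ht).vecMul_dualIdem hu
  | algebraMap c =>
    intro f hf r hr y z hy hz
    simp only [Matrix.algebraMap_eq_diagonal, Matrix.vecMul_diagonal, hf r hr y z hy hz,
      Pi.algebraMap_apply]
  | add a b _ _ iha ihb =>
    intro f hf r hr y z hy hz
    simp only [Matrix.vecMul_add, Pi.add_apply, iha hf r hr y z hy hz, ihb hf r hr y z hy hz]
  | mul a b _ _ iha ihb =>
    intro f hf
    rw [← Matrix.vecMul_vecMul]
    exact ihb (iha hf)

lemma transpose_mem_terwAlg {R : Type*} [CommRing R] {A : AssocScheme X} {x : X}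
    {a : Matrix X X R} (ha : a ∈ TerwAlg R A x) : aᵀ ∈ TerwAlg R A x := by
  induction ha using Algebra.adjoin_induction with
  | mem m hm =>
    obtain ⟨s, hs, t, ht, u, hu, rfl⟩ := hm
    refine Algebra.subset_adjoin ⟨u, hu, _, A.star_mem t ht, s, hs, ?_⟩
    simp only [Matrix.transpose_mul, transpose_dualIdem, transpose_adjMat, Matrix.mul_assoc]
  | algebraMap c =>
    rw [Matrix.algebraMap_eq_diagonal, Matrix.diagonal_transpose, ← Matrix.algebraMap_eq_diagonal]
    exact Subalgebra.algebraMap_mem _ c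
  | add a b _ _ iha ihb => exact add_mem iha ihb
  | mul a b _ _ iha ihb =>
    rw [Matrix.transpose_mul]
    exact mul_mem ihb iha

lemma fiberInd_vecMul_corner {R : Type*} [CommRing R] {A : AssocScheme X} {x : X}
    {s : Finset (X × X)} (hs : s ∈ A.S) {a : Matrix X X R} (ha : a ∈ TerwAlg R A x) :
    ∃ c : R, fiberInd R x s ᵥ* (dualIdem R x s * a * dualIdem R x s) = c • fiberInd R x s := by
  have hf : A.FiberConst x (fiberInd R x s ᵥ* dualIdem R x s ᵥ* a) :=
    ((A.fiberConst_fiberInd x hs).vecMul_dualIdem hs).vecMul ha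
  rw [← Matrix.vecMul_vecMul, ← Matrix.vecMul_vecMul]
  generalize fiberInd R x s ᵥ* dualIdem R x s ᵥ* a = g at hf
  by_cases hne : ∃ y, (x, y) ∈ s
  · obtain ⟨y, hy⟩ := hne
    refine ⟨g y, funext fun z => ?_⟩
    by_cases hz : (x, z) ∈ s
    · simp [dualIdem, Matrix.vecMul_diagonal, fiberInd, hz, hf s hs z y hz hy]
    · simp [dualIdem, Matrix.vecMul_diagonal, fiberInd, hz]
  · push Not at hne
    refine ⟨0, funext fun z => ?_⟩
    simp [dualIdem, hne]

lemma corner_mulVec_fiberInd {R : Type*} [CommRing R] {A : AssocScheme X} {x : X}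
    {s : Finset (X × X)} (hs : s ∈ A.S) {a : Matrix X X R} (ha : a ∈ TerwAlg R A x) :
    ∃ c : R, (dualIdem R x s * a * dualIdem R x s) *ᵥ fiberInd R x s = c • fiberInd R x s := by
  obtain ⟨c, hc⟩ := fiberInd_vecMul_corner hs (transpose_mem_terwAlg ha)
  refine ⟨c, ?_⟩
  rw [← hc, ← Matrix.vecMul_transpose]
  simp only [Matrix.transpose_mul, transpose_dualIdem, Matrix.mul_assoc]

lemma dualIdem_mul_ones_mul_dualIdem_mem_terwAlg {R : Type*} [CommRing R] {A : AssocScheme X}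
    (x : X) {s : Finset (X × X)} (hs : s ∈ A.S) :
    dualIdem R x s * Matrix.of (fun _ _ => (1 : R)) * dualIdem R x s ∈ TerwAlg R A x := by
  rw [← A.sum_adjMat, Finset.mul_sum, Finset.sum_mul]
  exact sum_mem fun t ht => Algebra.subset_adjoin ⟨s, hs, t, ht, s, hs, rfl⟩

/-- **Lemma.** `K·E_s* J E_s*` is a one-dimensional two-sided ideal of the corner algebra
`E_s* (KT(x)) E_s*`, where `J` is the all-ones matrix. -/
theorem span_EJE_one_dim_ideal (A : AssocScheme X) (x : X) (s : Finset (X × X))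
    (hs : s ∈ A.S) (hxs : ∃ y, (x, y) ∈ s) (K : Type*) [Field K] :
    (dualIdem K x s * Matrix.of (fun _ _ => (1 : K)) * dualIdem K x s)
      ∈ {m | ∃ a ∈ TerwAlg K A x, m = dualIdem K x s * a * dualIdem K x s} ∧
    Module.finrank K (Submodule.span K
      {dualIdem K x s * Matrix.of (fun _ _ => (1 : K)) * dualIdem K x s}) = 1 ∧
    ∀ a ∈ TerwAlg K A x,
      (dualIdem K x s * a * dualIdem K x s) *
          (dualIdem K x s * Matrix.of (fun _ _ => (1 : K)) * dualIdem K x s)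
        ∈ Submodule.span K
          {dualIdem K x s * Matrix.of (fun _ _ => (1 : K)) * dualIdem K x s} ∧
      (dualIdem K x s * Matrix.of (fun _ _ => (1 : K)) * dualIdem K x s) *
          (dualIdem K x s * a * dualIdem K x s)
        ∈ Submodule.span K
          {dualIdem K x s * Matrix.of (fun _ _ => (1 : K)) * dualIdem K x s} := by
  refine ⟨⟨_, dualIdem_mul_ones_mul_dualIdem_mem_terwAlg x hs, ?_⟩, ?_, fun a ha => ?_⟩
  · simp only [Matrix.mul_assoc, dualIdem_mul_self]
    simp only [← Matrix.mul_assoc, dualIdem_mul_self]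
  · obtain ⟨y, hy⟩ := hxs
    rw [dualIdem_mul_ones_mul_dualIdem]
    refine finrank_span_singleton fun h => ?_
    simpa [vecMulVec_apply, fiberInd, hy] using congrFun (congrFun h y) y
  · rw [dualIdem_mul_ones_mul_dualIdem]
    obtain ⟨c, hc⟩ := corner_mulVec_fiberInd hs ha
    obtain ⟨d, hd⟩ := fiberInd_vecMul_corner hs ha
    rw [Matrix.mul_vecMulVec, Matrix.vecMulVec_mul, hc, hd, Matrix.smul_vecMulVec,
      Matrix.vecMulVec_smul]
    exact ⟨Submodule.smul_mem _ _ (Submodule.mem_span_singleton_self _),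
      Submodule.smul_mem _ _ (Submodule.mem_span_singleton_self _)⟩
end

section
/- Let (X,S) be an association scheme and x ∈ X. Then ℚT(x) ∩ M_X(ℤ) = ℤT(x) if and only if for every field K one has dim_K KT(x) = dim_ℂ ℂT(x). -/
open Matrix

variable {X : Type*} [Fintype X] [DecidableEq X]

/-- The entrywise image of an integer matrix in a ring. -/
abbrev castMat (K : Type*) [Ring K] : Matrix X X ℤ →+* Matrix X X K :=
  (Int.castRingHom K).mapMatrix

theorem castMat_zsmul (K : Type*) [Ring K] (c : ℤ) (m : Matrix X X ℤ) :
    castMat K (c • m) = (c : K) • castMat K m := by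
  rw [map_zsmul, Int.cast_smul_eq_zsmul]

theorem castMat_mem_span {K : Type*} [Ring K] {s : Set (Matrix X X ℤ)} {m : Matrix X X ℤ}
    (hm : m ∈ Submodule.span ℤ s) : castMat K m ∈ Submodule.span K (castMat K '' s) := by
  induction hm using Submodule.span_induction with
  | mem m hm => exact Submodule.subset_span ⟨m, hm, rfl⟩
  | zero => rw [map_zero]; exact zero_mem _
  | add m n _ _ hm hn => rw [map_add]; exact add_mem hm hn
  | smul c m _ hm => rw [castMat_zsmul]; exact Submodule.smul_mem _ _ hm

theorem span_castMat_image_span (K : Type*) [Ring K] (s : Set (Matrix X X ℤ)) :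
    Submodule.span K (castMat K '' (Submodule.span ℤ s : Set (Matrix X X ℤ)))
      = Submodule.span K (castMat K '' s) := by
  refine le_antisymm (Submodule.span_le.2 ?_)
    (Submodule.span_mono (Set.image_mono Submodule.subset_span))
  rintro _ ⟨m, hm, rfl⟩
  exact castMat_mem_span hm

theorem castMat_adjMat (K : Type*) [Ring K] (s : Finset (X × X)) :
    castMat K (adjMat ℤ s) = adjMat K s := by
  ext y z
  simp only [castMat, adjMat, RingHom.mapMatrix_apply, Matrix.map_apply, Matrix.of_apply]
  split_ifs <;> simp

theorem castMat_dualIdem (K : Type*) [Ring K] (x : X) (s : Finset (X × X)) :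
    castMat K (dualIdem ℤ x s) = dualIdem K x s := by
  ext y z
  simp only [castMat, dualIdem, RingHom.mapMatrix_apply, Matrix.map_apply, Matrix.diagonal_apply]
  split_ifs <;> simp

theorem toSubmodule_adjoin_castMat_image (K : Type*) [CommRing K] (s : Set (Matrix X X ℤ)) :
    (Algebra.adjoin K (castMat K '' s)).toSubmodule
      = Submodule.span K (castMat K '' (Algebra.adjoin ℤ s : Set (Matrix X X ℤ))) := by
  have hclosure : (Submonoid.closure (castMat K '' s) : Set (Matrix X X K))
      = castMat K '' (Submonoid.closure s : Set (Matrix X X ℤ)) := by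
    have := MonoidHom.map_mclosure (castMat K : Matrix X X ℤ →+* Matrix X X K).toMonoidHom s
    exact (congrArg SetLike.coe this).symm
  have hspan : (Algebra.adjoin ℤ s : Set (Matrix X X ℤ))
      = (Submodule.span ℤ (Submonoid.closure s : Set (Matrix X X ℤ)) : Set (Matrix X X ℤ)) :=
    congrArg SetLike.coe (Algebra.adjoin_eq_span ℤ s)
  rw [Algebra.adjoin_eq_span, hclosure, hspan, span_castMat_image_span]

/-- The Terwilliger algebra over `K` is spanned by the image of the integral one. -/
theorem toSubmodule_terwAlg_eq_span (K : Type*) [CommRing K] (A : AssocScheme X) (x : X) :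
    (TerwAlg K A x).toSubmodule
      = Submodule.span K (castMat K '' (TerwAlg ℤ A x : Set (Matrix X X ℤ))) := by
  have hgen : {m : Matrix X X K | ∃ s ∈ A.S, ∃ t ∈ A.S, ∃ u ∈ A.S,
        m = dualIdem K x s * adjMat K t * dualIdem K x u}
      = castMat K '' {m | ∃ s ∈ A.S, ∃ t ∈ A.S, ∃ u ∈ A.S,
        m = dualIdem ℤ x s * adjMat ℤ t * dualIdem ℤ x u} := by
    ext m
    constructor
    · rintro ⟨s, hs, t, ht, u, hu, rfl⟩
      exact ⟨_, ⟨s, hs, t, ht, u, hu, rfl⟩, by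
        rw [map_mul, map_mul, castMat_adjMat, castMat_dualIdem, castMat_dualIdem]⟩
    · rintro ⟨_, ⟨s, hs, t, ht, u, hu, rfl⟩, rfl⟩
      exact ⟨s, hs, t, ht, u, hu, by
        rw [map_mul, map_mul, castMat_adjMat, castMat_dualIdem, castMat_dualIdem]⟩
  rw [TerwAlg, TerwAlg, hgen]
  exact toSubmodule_adjoin_castMat_image K _

theorem span_castMat_basis {K : Type*} [CommRing K] {ι : Type*}
    (b : Module.Basis ι ℤ (Matrix X X ℤ)) :
    ⊤ ≤ Submodule.span K (Set.range fun i => castMat K (b i)) := by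
  have h : ∀ m : Matrix X X ℤ,
      castMat K m ∈ Submodule.span K (Set.range fun i => castMat K (b i)) := fun m => by
    have := castMat_mem_span (K := K) (b.mem_span m)
    rwa [← Set.range_comp] at this
  rw [← (Matrix.stdBasis K X X).span_eq, Submodule.span_le]
  rintro _ ⟨⟨y, z⟩, rfl⟩
  have := h (Matrix.single y z 1)
  rwa [RingHom.mapMatrix_apply, Matrix.map_single _ _ _ (Int.castRingHom K), map_one,
    ← Matrix.stdBasis_eq_single] at this

/-- A `ℤ`-basis of the integer matrices gives a basis of the matrices over any field. -/
noncomputable def castBasis (K : Type*) [Field K] {ι : Type*} [Fintype ι]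
    (b : Module.Basis ι ℤ (Matrix X X ℤ)) : Module.Basis ι K (Matrix X X K) :=
  basisOfTopLeSpanOfCardEqFinrank (fun i => castMat K (b i)) (span_castMat_basis b) (by
    rw [← Module.finrank_eq_card_basis b, Module.finrank_matrix, Module.finrank_matrix,
      Module.finrank_self, Module.finrank_self])

@[simp]
theorem castBasis_apply (K : Type*) [Field K] {ι : Type*} [Fintype ι]
    (b : Module.Basis ι ℤ (Matrix X X ℤ)) (i : ι) : castBasis K b i = castMat K (b i) := by
  simp [castBasis]

theorem castBasis_repr_castMat (K : Type*) [Field K] {ι : Type*} [Fintype ι]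
    (b : Module.Basis ι ℤ (Matrix X X ℤ)) (m : Matrix X X ℤ) (i : ι) :
    (castBasis K b).repr (castMat K m) i = (b.repr m i : K) := by
  classical
  conv_lhs => rw [← b.sum_repr m, map_sum]
  simp_rw [castMat_zsmul, ← castBasis_apply]
  rw [Module.Basis.repr_sum_self]

theorem span_range_coe_bN {R M ι : Type*} [CommRing R] [AddCommGroup M] [Module R M]
    {N : Submodule R M} {n : ℕ} (B : Module.Basis.SmithNormalForm N ι n) :
    Submodule.span R (Set.range fun i => (B.bN i : M)) = N := by
  have := congrArg (Submodule.map N.subtype) B.bN.span_eq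
  rwa [Submodule.map_span, ← Set.range_comp, Submodule.map_top, Submodule.range_subtype] at this

theorem smithNormalForm_a_ne_zero {R M ι : Type*} [CommRing R] [Nontrivial R]
    [AddCommGroup M] [Module R M] {N : Submodule R M} {n : ℕ}
    (B : Module.Basis.SmithNormalForm N ι n) (i : Fin n) :
    B.a i ≠ 0 := by
  intro h
  have := B.snf i
  rw [h, zero_smul] at this
  exact B.bN.ne_zero i (Subtype.ext this)

section SmithNormalForm

variable {N : Submodule ℤ (Matrix X X ℤ)} {ι : Type*} [Fintype ι] {n : ℕ}

theorem castMat_bN (K : Type*) [Field K] (B : Module.Basis.SmithNormalForm N ι n) (i : Fin n) :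
    castMat K (B.bN i : Matrix X X ℤ) = (B.a i : K) • castBasis K B.bM (B.f i) := by
  rw [B.snf, castMat_zsmul, castBasis_apply]

theorem span_castMat_image_eq (K : Type*) [Field K] (B : Module.Basis.SmithNormalForm N ι n) :
    Submodule.span K (castMat K '' (N : Set (Matrix X X ℤ)))
      = Submodule.span K (Set.range fun i => (B.a i : K) • castBasis K B.bM (B.f i)) := by
  conv_lhs => rw [← span_range_coe_bN B]
  rw [span_castMat_image_span, ← Set.range_comp]
  simp_rw [← castMat_bN]
  rfl

/-- The span of a lattice over `K` has full dimension iff the invariant factors survive in `K`. -/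
theorem finrank_span_castMat_eq_iff (K : Type*) [Field K]
    (B : Module.Basis.SmithNormalForm N ι n) :
    Module.finrank K (Submodule.span K (castMat K '' (N : Set (Matrix X X ℤ)))) = n ↔
      ∀ i, (B.a i : K) ≠ 0 := by
  rw [span_castMat_image_eq K B]
  have key := linearIndependent_iff_card_eq_finrank_span
    (R := K) (b := fun i => (B.a i : K) • castBasis K B.bM (B.f i))
  rw [Fintype.card_fin, eq_comm, Set.finrank] at key
  rw [← key]
  constructor
  · intro h i hi
    exact h.ne_zero i (by simp [hi])
  · intro h
    exact ((castBasis K B.bM).linearIndependent.comp B.f B.f.injective).units_smul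
      fun i => Units.mk0 _ (h i)

/-- A lattice of integer matrices is saturated iff its invariant factors are units. -/
theorem saturated_iff_isUnit (B : Module.Basis.SmithNormalForm N ι n) :
    {m | castMat ℚ m ∈ Submodule.span ℚ (castMat ℚ '' (N : Set (Matrix X X ℤ)))}
      = (N : Set (Matrix X X ℤ)) ↔ ∀ i, IsUnit (B.a i) := by
  constructor
  · intro h i
    have hmem : B.bM (B.f i) ∈ N := by
      rw [← SetLike.mem_coe, ← h, Set.mem_ofPred_eq, span_castMat_image_eq ℚ B, ← castBasis_apply]
      have ha : (B.a i : ℚ) ≠ 0 := Int.cast_ne_zero.2 (smithNormalForm_a_ne_zero B i)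
      rw [← Submodule.smul_mem_iff _ ha]
      exact Submodule.subset_span ⟨i, rfl⟩
    have hsmul : B.bN i = B.a i • ⟨B.bM (B.f i), hmem⟩ := Subtype.ext (B.snf i)
    have := congrArg (fun m => B.bN.repr m i) hsmul
    simp only [Module.Basis.repr_self, Finsupp.single_eq_same, map_smul, Finsupp.smul_apply,
      smul_eq_mul] at this
    exact IsUnit.of_mul_eq_one _ this.symm
  · intro h
    refine Set.Subset.antisymm (fun m hm => ?_) fun m hm => Submodule.subset_span ⟨m, hm, rfl⟩
    have hsupp : castMat ℚ m ∈ Submodule.span ℚ (castBasis ℚ B.bM '' Set.range B.f) := by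
      rw [Set.mem_ofPred_eq, span_castMat_image_eq ℚ B] at hm
      refine Submodule.span_le.2 ?_ hm
      rintro _ ⟨i, rfl⟩
      exact Submodule.smul_mem _ _ (Submodule.subset_span ⟨_, ⟨i, rfl⟩, rfl⟩)
    have hm' : m ∈ Submodule.span ℤ (B.bM '' Set.range B.f) := by
      rw [Module.Basis.mem_span_image] at hsupp ⊢
      intro j hj
      apply hsupp
      simp only [Finset.mem_coe, Finsupp.mem_support_iff] at hj ⊢
      rwa [castBasis_repr_castMat, Int.cast_ne_zero]
    refine Submodule.span_le.2 ?_ hm'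
    rintro _ ⟨_, ⟨i, rfl⟩, rfl⟩
    obtain ⟨u, hu⟩ := h i
    have : B.bM (B.f i) = (↑u⁻¹ : ℤ) • (B.bN i : Matrix X X ℤ) := by
      rw [B.snf, ← hu, smul_smul, Units.inv_mul, one_smul]
    rw [this]
    exact N.smul_mem _ (B.bN i).2

end SmithNormalForm

theorem Int.isUnit_iff_forall_field_cast_ne_zero {a : ℤ} :
    IsUnit a ↔ ∀ (K : Type) [Field K], (a : K) ≠ 0 := by
  constructor
  · intro h K _
    exact (h.map (Int.castRingHom K)).ne_zero
  · intro h
    rw [Int.isUnit_iff_natAbs_eq]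
    by_contra hne
    obtain ⟨p, hp, hdvd⟩ := Nat.exists_prime_and_dvd hne
    have := Fact.mk hp
    exact h (ZMod p) ((ZMod.intCast_zmod_eq_zero_iff_dvd a p).2 (Int.natCast_dvd.2 hdvd))

/-- **Proposition.** `ℚT(x) ∩ M_X(ℤ) = ℤT(x)` if and only if `dim_K KT(x) = dim_ℂ ℂT(x)`
for every field `K`. -/
theorem int_lattice_eq_iff_dim_const (A : AssocScheme X) (x : X) :
    {m : Matrix X X ℤ | m.map (Int.cast : ℤ → ℚ) ∈ TerwAlg ℚ A x}
        = (TerwAlg ℤ A x : Set (Matrix X X ℤ)) ↔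
      ∀ (K : Type) [Field K],
        Module.finrank K (TerwAlg K A x) = Module.finrank ℂ (TerwAlg ℂ A x) := by
  obtain ⟨n, B⟩ := Submodule.smithNormalForm (Matrix.stdBasis ℤ X X) (TerwAlg ℤ A x).toSubmodule
  have hfin : ∀ (K : Type) [Field K],
      Module.finrank K (TerwAlg K A x) = n ↔ ∀ i, (B.a i : K) ≠ 0 := fun K _ => by
    rw [← Subalgebra.finrank_toSubmodule, toSubmodule_terwAlg_eq_span]
    exact finrank_span_castMat_eq_iff K B
  have hC : Module.finrank ℂ (TerwAlg ℂ A x) = n :=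
    (hfin ℂ).2 fun i => Int.cast_ne_zero.2 (smithNormalForm_a_ne_zero B i)
  have hset : {m : Matrix X X ℤ | m.map (Int.cast : ℤ → ℚ) ∈ TerwAlg ℚ A x}
      = {m | castMat ℚ m ∈ Submodule.span ℚ
          (castMat ℚ '' ((TerwAlg ℤ A x).toSubmodule : Set (Matrix X X ℤ)))} := by
    ext m
    rw [Set.mem_ofPred_eq, Set.mem_ofPred_eq, ← Subalgebra.mem_toSubmodule,
      toSubmodule_terwAlg_eq_span]
    rfl
  rw [hset, ← Subalgebra.coe_toSubmodule, saturated_iff_isUnit B, hC]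
  simp_rw [hfin, Int.isUnit_iff_forall_field_cast_ne_zero]
  exact ⟨fun h K _ i => h i K, fun h i K _ => h K i⟩
end

section
/- Let (X,S) be an association scheme and x ∈ X. If K and K' are fields of the same characteristic, then dim_K KT(x) = dim_{K'} K'T(x). In particular, the semisimplicity of KT(x) also depends only on the characteristic of K. -/
open Matrix

variable {X : Type*} [Fintype X] [DecidableEq X]

open TensorProduct

section Separability

/-- An algebra is separable if it has a separability idempotent: an element of `A ⊗ A` that
multiplies to `1` and on which the two outer (bimodule) actions of `A` agree. -/
def HasSeparabilityIdempotent (F A : Type*) [CommRing F] [Ring A] [Algebra F A] : Prop :=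
  ∃ e : A ⊗[F] A, (∀ a : A, (LinearMap.mulLeft F a).rTensor A e =
    (LinearMap.mulRight F a).lTensor A e) ∧ LinearMap.mul' F A e = 1

variable {F : Type*} [Field F]

theorem hasSeparabilityIdempotent_of_isSeparable (L : Type*) [Field L] [Algebra F L]
    [Module.Finite F L] [Algebra.IsSeparable F L] : HasSeparabilityIdempotent F L := by
  obtain ⟨e, he, h1⟩ := (Algebra.FormallyUnramified.iff_exists_tensorProduct (R := F) (S := L)).1
    (Algebra.FormallyUnramified.of_isSeparable F L)
  refine ⟨e, fun a => ?_, ?_⟩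
  · have hl : ∀ t : L ⊗[F] L, (LinearMap.mulLeft F a).rTensor L t = (a ⊗ₜ[F] (1 : L)) * t := by
      intro t
      induction t with
      | zero => simp
      | tmul x y => simp
      | add x y hx hy => simp [hx, hy, mul_add]
    have hr : ∀ t : L ⊗[F] L, (LinearMap.mulRight F a).lTensor L t = ((1 : L) ⊗ₜ[F] a) * t := by
      intro t
      induction t with
      | zero => simp
      | tmul x y => simp [mul_comm]
      | add x y hx hy => simp [hx, hy, mul_add]
    rw [hl, hr]
    exact (sub_eq_zero.1 (by rw [← sub_mul]; exact he a)).symm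
  · exact h1

theorem hasSeparabilityIdempotent_divisionRing [Finite F] (D : Type*) [DivisionRing D]
    [Algebra F D] [Module.Finite F D] : HasSeparabilityIdempotent F D := by
  have : Finite D := Module.finite_of_finite F
  let := littleWedderburn D
  exact hasSeparabilityIdempotent_of_isSeparable D

theorem HasSeparabilityIdempotent.matrix {D : Type*} [Ring D] [Algebra F D]
    (h : HasSeparabilityIdempotent F D) (n : Type*) [Fintype n] [DecidableEq n] [Nonempty n] :
    HasSeparabilityIdempotent F (Matrix n n D) := by
  obtain ⟨e, he, h1⟩ := h
  let o : n := Classical.arbitrary n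
  let T (i k : n) : D ⊗[F] D →ₗ[F] Matrix n n D ⊗[F] Matrix n n D :=
    TensorProduct.map (Matrix.singleLinearMap F i o) (Matrix.singleLinearMap F o k)
  have hL : ∀ (j k i : n) (d : D) (t : D ⊗[F] D),
      (LinearMap.mulLeft F (Matrix.single j k d)).rTensor _ (T i i t) =
        if k = i then T j i ((LinearMap.mulLeft F d).rTensor _ t) else 0 := by
    intro j k i d t
    induction t with
    | zero => simp
    | tmul x y =>
      split_ifs with hk
      · subst hk; simp [T]
      · simp [T, Matrix.single_mul_single_of_ne, hk]
    | add x y hx hy => simp only [map_add, hx, hy]; split_ifs <;> simp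
  have hR : ∀ (j k i : n) (d : D) (t : D ⊗[F] D),
      (LinearMap.mulRight F (Matrix.single j k d)).lTensor _ (T i i t) =
        if i = j then T i k ((LinearMap.mulRight F d).lTensor _ t) else 0 := by
    intro j k i d t
    induction t with
    | zero => simp
    | tmul x y =>
      split_ifs with hk
      · subst hk; simp [T]
      · simp [T, Matrix.single_mul_single_of_ne, hk]
    | add x y hx hy => simp only [map_add, hx, hy]; split_ifs <;> simp
  have hM : ∀ (i : n) (t : D ⊗[F] D), LinearMap.mul' F _ (T i i t) =
      Matrix.single i i (LinearMap.mul' F _ t) := by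
    intro i t
    induction t with
    | zero => simp
    | tmul x y => simp [T]
    | add x y hx hy => simp only [map_add, hx, hy, Matrix.single_add]
  refine ⟨∑ i, T i i e, fun a => ?_, ?_⟩
  · induction a using Matrix.induction_on' with
    | h_zero => simp
    | h_add p q hp hq =>
      have e1 : LinearMap.mulLeft F (p + q) = LinearMap.mulLeft F p + LinearMap.mulLeft F q := by
        ext; simp [add_mul]
      have e2 : LinearMap.mulRight F (p + q) =
          LinearMap.mulRight F p + LinearMap.mulRight F q := by
        ext; simp [mul_add]
      rw [e1, e2, LinearMap.rTensor_add, LinearMap.lTensor_add, LinearMap.add_apply,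
        LinearMap.add_apply, hp, hq]
    | h_std_basis j k d => simp [map_sum, hL, hR, he]
  · simp only [map_sum, hM, h1]
    exact Matrix.sum_single_one

theorem HasSeparabilityIdempotent.pi {ι : Type*} [Fintype ι] [DecidableEq ι] {A : ι → Type*}
    [∀ i, Ring (A i)] [∀ i, Algebra F (A i)] (h : ∀ i, HasSeparabilityIdempotent F (A i)) :
    HasSeparabilityIdempotent F (∀ i, A i) := by
  choose e he h1 using h
  let T (i : ι) : A i ⊗[F] A i →ₗ[F] (∀ i, A i) ⊗[F] (∀ i, A i) :=
    TensorProduct.map (LinearMap.single F A i) (LinearMap.single F A i)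
  have hL : ∀ (a : ∀ i, A i) (i : ι) (t : A i ⊗[F] A i),
      (LinearMap.mulLeft F a).rTensor _ (T i t) = T i ((LinearMap.mulLeft F (a i)).rTensor _ t) := by
    intro a i t
    induction t with
    | zero => simp
    | tmul x y => simp [T, Pi.single_mul_right]
    | add x y hx hy => simp only [map_add, hx, hy]
  have hR : ∀ (a : ∀ i, A i) (i : ι) (t : A i ⊗[F] A i),
      (LinearMap.mulRight F a).lTensor _ (T i t) =
        T i ((LinearMap.mulRight F (a i)).lTensor _ t) := by
    intro a i t
    induction t with
    | zero => simp
    | tmul x y => simp [T, Pi.single_mul_left]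
    | add x y hx hy => simp only [map_add, hx, hy]
  have hM : ∀ (i : ι) (t : A i ⊗[F] A i), LinearMap.mul' F _ (T i t) =
      Pi.single i (LinearMap.mul' F _ t) := by
    intro i t
    induction t with
    | zero => simp
    | tmul x y => simp [T, Pi.single_mul]
    | add x y hx hy => simp only [map_add, hx, hy, Pi.single_add]
  refine ⟨∑ i, T i (e i), fun a => ?_, ?_⟩
  · simp only [map_sum, hL, hR, he]
  · simp only [map_sum, hM, h1]
    exact Finset.univ_sum_single (1 : ∀ i, A i)

variable {K A B : Type*} [Field K] [Algebra F K] [Ring A] [Algebra F A] [Ring B] [Algebra K B]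
  [Algebra F B] [IsScalarTower F K B]

/-- Maschke's averaging argument: an algebra spanned over `K` by the image of a separable algebra
is semisimple. -/
theorem HasSeparabilityIdempotent.isSemisimpleRing_of_span_range
    (h : HasSeparabilityIdempotent F A) (f : A →ₐ[F] B)
    (hf : Submodule.span K (Set.range f) = ⊤) : IsSemisimpleRing B := by
  obtain ⟨e, he, h1⟩ := h
  refine (isSemisimpleModule_iff B B).2 ⟨fun I => ?_⟩
  obtain ⟨p, hp⟩ := (I.restrictScalars K).exists_isCompl
  let π : B →ₗ[K] B := (I.restrictScalars K).subtype ∘ₗ Submodule.projectionOnto _ _ hp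
  have hπI (y : B) : π y ∈ I := (Submodule.projectionOnto _ _ hp y).2
  have hπ (y : B) (hy : y ∈ I) : π y = y :=
    congrArg Subtype.val (Submodule.projectionOnto_apply_left hp ⟨y, hy⟩)
  let T (m : B) : A ⊗[F] A →ₗ[F] B := TensorProduct.lift <| LinearMap.mk₂ F
    (fun x y => f x * π (f y * m)) (fun x x' y => by simp [add_mul]) (fun c x y => by simp)
    (fun x y y' => by simp [add_mul, mul_add])
    (fun c x y => by
      rw [map_smul, smul_mul_assoc, ← algebraMap_smul K c (f y * m), map_smul, algebraMap_smul,
        mul_smul_comm])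
  have hT (m : B) (x y : A) : T m (x ⊗ₜ y) = f x * π (f y * m) := rfl
  have hTl (m : B) (a : A) (t : A ⊗[F] A) :
      T m ((LinearMap.mulLeft F a).rTensor A t) = f a * T m t := by
    induction t with
    | zero => simp
    | tmul x y => simp [hT, mul_assoc]
    | add x y hx hy => simp only [map_add, hx, hy, mul_add]
  have hTr (m : B) (a : A) (t : A ⊗[F] A) :
      T m ((LinearMap.mulRight F a).lTensor A t) = T (f a * m) t := by
    induction t with
    | zero => simp
    | tmul x y => simp [hT, mul_assoc]
    | add x y hx hy => simp only [map_add, hx, hy]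
  have hTI (m : B) (t : A ⊗[F] A) : T m t ∈ I := by
    induction t with
    | zero => simp
    | tmul x y => exact Ideal.mul_mem_left I _ (hπI _)
    | add x y hx hy => rw [map_add]; exact I.add_mem hx hy
  have hTm (m : B) (hm : m ∈ I) (t : A ⊗[F] A) : T m t = f (LinearMap.mul' F A t) * m := by
    induction t with
    | zero => simp
    | tmul x y => rw [hT, hπ _ (Ideal.mul_mem_left I _ hm)]; simp [mul_assoc]
    | add x y hx hy => simp only [map_add, hx, hy, add_mul]
  have hTadd (m m' : B) (t : A ⊗[F] A) : T (m + m') t = T m t + T m' t := by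
    induction t with
    | zero => simp
    | tmul x y => simp [hT, mul_add]
    | add x y hx hy => simp only [map_add, hx, hy]; abel
  have hTsmul (c : K) (m : B) (t : A ⊗[F] A) : T (c • m) t = c • T m t := by
    induction t with
    | zero => simp
    | tmul x y => simp [hT]
    | add x y hx hy => simp only [map_add, hx, hy, smul_add]
  have hTmul (b m : B) : T (b * m) e = b * T m e := by
    have hb : b ∈ Submodule.span K (Set.range f) := hf ▸ Submodule.mem_top
    induction hb using Submodule.span_induction with
    | mem b hb => obtain ⟨a, rfl⟩ := hb; rw [← hTr, ← he, hTl]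
    | zero => simpa using hTsmul 0 0 e
    | add x y _ _ hx hy => rw [add_mul, hTadd, hx, hy, add_mul]
    | smul c x _ hx => rw [smul_mul_assoc, hTsmul, hx, smul_mul_assoc]
  let P : B →ₗ[B] I :=
    { toFun := fun m => ⟨T m e, hTI m e⟩
      map_add' := fun m m' => Subtype.ext (hTadd m m' e)
      map_smul' := fun b m => Subtype.ext (hTmul b m) }
  exact ⟨_, LinearMap.isCompl_of_proj (f := P) fun m => Subtype.ext <| by
    change T m e = m
    rw [hTm m m.2 e, h1, map_one, one_mul]⟩

theorem IsSemisimpleRing.of_span_range [Finite F] [Module.Finite F A] (f : A →ₐ[F] B)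
    (hf : Submodule.span K (Set.range f) = ⊤) [IsSemisimpleRing A] : IsSemisimpleRing B := by
  obtain ⟨n, D, d, _, _, _, _, ⟨e⟩⟩ :=
    IsSemisimpleRing.exists_algEquiv_pi_matrix_divisionRing_finite F A
  have hsep : HasSeparabilityIdempotent F (∀ i, Matrix (Fin (d i)) (Fin (d i)) (D i)) :=
    .pi fun i => (hasSeparabilityIdempotent_divisionRing (D i)).matrix _
  refine hsep.isSemisimpleRing_of_span_range (K := K) (f.comp e.symm.toAlgHom) ?_
  rw [← hf]
  congr 1
  exact e.symm.surjective.range_comp f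

end Separability

section Descent

open scoped Pointwise

theorem Ring.mem_jacobson_of_forall_isNilpotent {R : Type*} [Ring R] {x : R}
    (h : ∀ y, IsNilpotent (y * x)) : x ∈ Ring.jacobson R := by
  rw [← Ideal.jacobson_bot, Ideal.mem_jacobson_iff]
  intro y
  obtain ⟨z, hz⟩ := (h y).isUnit_add_one.exists_left_inv
  exact ⟨z, by rw [Ideal.mem_bot, mul_assoc, ← mul_add_one, hz, sub_self]⟩

theorem IsArtinianRing.isNilpotent_of_mem_jacobson {R : Type*} [Ring R] [IsArtinianRing R] {x : R}
    (hx : x ∈ Ring.jacobson R) : IsNilpotent x := by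
  obtain ⟨n, hn⟩ := IsSemiprimaryRing.isNilpotent (R := R)
  exact ⟨n, (Submodule.mem_bot R).1 ((hn.trans Ideal.zero_eq_bot) ▸ Ideal.pow_mem_pow hx n)⟩

variable {F K A B : Type*} [Field F] [Field K] [Ring A] [Algebra F A] [Ring B] [Algebra K B]
  [Algebra F B]

theorem IsSemisimpleRing.of_injective_of_span_range [Module.Finite F A] (f : A →ₐ[F] B)
    (hinj : Function.Injective f) (hf : Submodule.span K (Set.range f) = ⊤)
    [IsSemisimpleRing B] : IsSemisimpleRing A := by
  have : IsArtinianRing A := .of_finite F A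
  rw [IsArtinianRing.isSemisimpleRing_iff_jacobson, eq_bot_iff]
  intro x hx
  obtain ⟨n, hn⟩ := IsSemiprimaryRing.isNilpotent (R := A)
  let J : Set A := Ring.jacobson A
  let I : Submodule K B := Submodule.span K (f '' J)
  have hpow (k : ℕ) : (f '' J) ^ k ⊆ f '' (Ring.jacobson A ^ k : Ideal A) := by
    induction k with
    | zero =>
      rw [pow_zero, Set.one_subset, Submodule.pow_zero]
      exact ⟨1, Submodule.one_le.1 le_rfl, map_one f⟩
    | succ k ih =>
      rw [pow_succ, Submodule.pow_succ]
      rintro _ ⟨_, h1, _, ⟨b, hb, rfl⟩, rfl⟩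
      obtain ⟨a, ha, rfl⟩ := ih h1
      exact ⟨a * b, Ideal.mul_mem_mul ha hb, map_mul f a b⟩
  have hI : I ^ n = ⊥ := by
    rw [Submodule.span_pow, Submodule.span_eq_bot]
    intro y hy
    obtain ⟨a, ha, rfl⟩ := hpow n hy
    rw [hn] at ha
    rw [(Submodule.mem_bot A).1 ha, map_zero]
  have hmul (b : B) (y : A) (hy : y ∈ J) : b * f y ∈ I := by
    have hb : b ∈ Submodule.span K (Set.range f) := hf ▸ Submodule.mem_top
    induction hb using Submodule.span_induction with
    | mem b hb =>
      obtain ⟨a, rfl⟩ := hb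
      rw [← map_mul]
      exact Submodule.subset_span ⟨_, Ideal.mul_mem_left _ a hy, rfl⟩
    | zero => simp
    | add u v _ _ hu hv => rw [add_mul]; exact I.add_mem hu hv
    | smul c u _ hu => rw [smul_mul_assoc]; exact I.smul_mem c hu
  have hfx : f x ∈ Ring.jacobson B := Ring.mem_jacobson_of_forall_isNilpotent fun b =>
    ⟨n, (Submodule.mem_bot K).1 (hI ▸ Submodule.pow_mem_pow I (hmul b x hx) n)⟩
  rw [IsSemisimpleRing.jacobson_eq_bot, Submodule.mem_bot] at hfx
  exact (Submodule.mem_bot A).2 (hinj (hfx.trans (map_zero f).symm))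

end Descent

theorem LinearIndependent.matrix_map_algebraMap {F K m n ι : Type*} [Field F] [Field K]
    [Algebra F K] {v : ι → Matrix m n F} (hv : LinearIndependent F v) :
    LinearIndependent K fun i => (v i).map (algebraMap F K) := by
  rw [linearIndependent_iff'] at hv ⊢
  intro s g hg i hi
  rw [← Module.forall_dual_apply_eq_zero_iff F]
  intro φ
  refine hv s (fun i => φ (g i)) ?_ i hi
  ext a b
  have := congrArg φ (congrFun (congrFun hg a) b)
  simpa [Matrix.sum_apply, mul_comm _ (algebraMap F K _), mul_comm _ (φ _),
    ← Algebra.smul_def, -mul_eq_zero] using this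

theorem adjMat_map {Y F K : Type*} [DecidableEq Y] [Field F] [Field K] [Algebra F K]
    (s : Finset (Y × Y)) : (adjMat F s).map (algebraMap F K) = adjMat K s := by
  ext y z
  simp only [adjMat, Matrix.map_apply, Matrix.of_apply]
  split_ifs <;> simp

theorem dualIdem_map {Y F K : Type*} [DecidableEq Y] [Field F] [Field K] [Algebra F K] (x : Y)
    (s : Finset (Y × Y)) : (dualIdem F x s).map (algebraMap F K) = dualIdem K x s := by
  rw [dualIdem, Matrix.diagonal_map (map_zero _), dualIdem]
  congr 1
  ext y
  split_ifs <;> simp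

namespace TerwAlg

variable (A : AssocScheme X) (x : X)

section BaseChange

variable (F K : Type*) [Field F] [Field K] [Algebra F K]

theorem map_generators :
    (Algebra.ofId F K).mapMatrix '' {m : Matrix X X F | ∃ s ∈ A.S, ∃ t ∈ A.S, ∃ u ∈ A.S,
      m = dualIdem F x s * adjMat F t * dualIdem F x u} =
    {m | ∃ s ∈ A.S, ∃ t ∈ A.S, ∃ u ∈ A.S,
      m = dualIdem K x s * adjMat K t * dualIdem K x u} := by
  have key (s t u : Finset (X × X)) :
      (Algebra.ofId F K).mapMatrix (dualIdem F x s * adjMat F t * dualIdem F x u) =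
        dualIdem K x s * adjMat K t * dualIdem K x u := by
    rw [map_mul, map_mul, ← dualIdem_map (F := F) (K := K), ← dualIdem_map (F := F) (K := K),
      ← adjMat_map (F := F) (K := K)]
    rfl
  ext m
  constructor
  · rintro ⟨_, ⟨s, hs, t, ht, u, hu, rfl⟩, rfl⟩
    exact ⟨s, hs, t, ht, u, hu, key s t u⟩
  · rintro ⟨s, hs, t, ht, u, hu, rfl⟩
    exact ⟨_, ⟨s, hs, t, ht, u, hu, rfl⟩, key s t u⟩

theorem map_le_restrictScalars :
    (TerwAlg F A x).map (Algebra.ofId F K).mapMatrix ≤ (TerwAlg K A x).restrictScalars F := by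
  rw [TerwAlg, AlgHom.map_adjoin, map_generators]
  exact Algebra.adjoin_le Algebra.subset_adjoin

theorem span_image_eq :
    Submodule.span K ((Algebra.ofId F K).mapMatrix '' (TerwAlg F A x : Set (Matrix X X F))) =
      Subalgebra.toSubmodule (TerwAlg K A x) := by
  apply le_antisymm
  · exact Submodule.span_le.2 (map_le_restrictScalars A x F K)
  · rw [TerwAlg, TerwAlg, Algebra.adjoin_eq_span, ← map_generators A x F K]
    apply Submodule.span_mono
    have h := MonoidHom.map_mclosure ((Algebra.ofId F K).mapMatrix (m := X))
      {m | ∃ s ∈ A.S, ∃ t ∈ A.S, ∃ u ∈ A.S, m = dualIdem F x s * adjMat F t * dualIdem F x u}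
    rintro m hm
    obtain ⟨a, ha, rfl⟩ := h.ge hm
    have hle : Submonoid.closure _ ≤ (TerwAlg F A x).toSubmonoid :=
      Submonoid.closure_le.2 Algebra.subset_adjoin
    exact ⟨a, hle ha, rfl⟩

/-- Extension of scalars `FT(x) → KT(x)`, entry by entry. -/
def extend : TerwAlg F A x →ₐ[F] TerwAlg K A x :=
  ((Algebra.ofId F K).mapMatrix.comp (TerwAlg F A x).val).codRestrict
    ((TerwAlg K A x).restrictScalars F)
    fun a => map_le_restrictScalars A x F K ⟨a, a.2, rfl⟩

theorem coe_extend (a : TerwAlg F A x) :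
    (extend A x F K a : Matrix X X K) = (a : Matrix X X F).map (algebraMap F K) := rfl

theorem extend_injective : Function.Injective (extend A x F K) := fun _ _ h =>
  Subtype.ext (Matrix.map_injective (algebraMap F K).injective (congrArg Subtype.val h))

theorem span_range_extend : Submodule.span K (Set.range (extend A x F K)) = ⊤ := by
  apply Submodule.map_injective_of_injective
    (f := (Subalgebra.toSubmodule (TerwAlg K A x)).subtype) Subtype.val_injective
  rw [Submodule.map_span, Submodule.map_top, Submodule.range_subtype, ← Set.range_comp]
  refine Eq.trans ?_ (span_image_eq A x F K)
  congr 1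
  ext m
  simp only [Set.mem_range, Set.mem_image, Subtype.exists]
  exact ⟨fun ⟨a, ha, h⟩ => ⟨a, ha, h⟩, fun ⟨a, ha, h⟩ => ⟨a, ha, h⟩⟩

theorem span_range_extend_basis {ι : Type*} [Fintype ι] (b : Module.Basis ι F (TerwAlg F A x)) :
    Submodule.span K (Set.range fun i => extend A x F K (b i)) = ⊤ := by
  rw [eq_top_iff, ← span_range_extend A x F K, Submodule.span_le]
  rintro _ ⟨a, rfl⟩
  rw [← b.sum_repr a, map_sum]
  refine Submodule.sum_mem _ fun i _ => ?_
  rw [map_smul, ← algebraMap_smul K]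
  exact Submodule.smul_mem _ _ (Submodule.subset_span ⟨i, rfl⟩)

theorem finrank_eq : Module.finrank K (TerwAlg K A x) = Module.finrank F (TerwAlg F A x) := by
  let b := Module.finBasis F (TerwAlg F A x)
  have hb : LinearIndependent F fun i => (b i : Matrix X X F) :=
    b.linearIndependent.map' (Subalgebra.toSubmodule (TerwAlg F A x)).subtype
      (Submodule.ker_subtype _)
  have hK : LinearIndependent K fun i => extend A x F K (b i) :=
    .of_comp (Subalgebra.toSubmodule (TerwAlg K A x)).subtype hb.matrix_map_algebraMap
  rw [Module.finrank_eq_card_basis (Module.Basis.mk hK (span_range_extend_basis A x F K b).ge), Fintype.card_fin]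

theorem isSemisimpleRing_iff [Finite F] :
    IsSemisimpleRing (TerwAlg F A x) ↔ IsSemisimpleRing (TerwAlg K A x) :=
  ⟨fun _ => .of_span_range (extend A x F K) (span_range_extend A x F K),
    fun _ => .of_injective_of_span_range (extend A x F K) (extend_injective A x F K)
      (span_range_extend A x F K)⟩

end BaseChange

theorem transpose_mem (R : Type*) [CommRing R] {m : Matrix X X R} (hm : m ∈ TerwAlg R A x) :
    mᵀ ∈ TerwAlg R A x := by
  induction hm using Algebra.adjoin_induction with
  | mem m hm =>
    obtain ⟨s, hs, t, ht, u, hu, rfl⟩ := hm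
    refine Algebra.subset_adjoin ⟨u, hu, _, A.star_mem t ht, s, hs, ?_⟩
    have h : (adjMat R t)ᵀ = adjMat R (t.image fun p => (p.2, p.1)) := by
      ext y z
      simp [adjMat]
    rw [Matrix.transpose_mul, Matrix.transpose_mul, h, ← mul_assoc]
    simp [dualIdem]
  | algebraMap r =>
    rw [Matrix.algebraMap_eq_diagonal, Matrix.diagonal_transpose, ← Matrix.algebraMap_eq_diagonal]
    exact Subalgebra.algebraMap_mem _ r
  | add a b _ _ ha hb => rw [Matrix.transpose_add]; exact add_mem ha hb
  | mul a b _ _ ha hb => rw [Matrix.transpose_mul]; exact mul_mem hb ha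

/-- In characteristic zero the trace form on the rational Terwilliger algebra is nondegenerate,
because that algebra is closed under transposition; this persists after extension of scalars. -/
theorem isSemisimpleRing_of_charZero (K : Type*) [Field K] [CharZero K] :
    IsSemisimpleRing (TerwAlg K A x) := by
  have : IsArtinianRing (TerwAlg K A x) := .of_finite K _
  rw [IsArtinianRing.isSemisimpleRing_iff_jacobson, eq_bot_iff]
  intro y hy
  let b := Module.finBasis ℚ (TerwAlg ℚ A x)
  let G : Matrix _ _ ℚ := Matrix.of fun i j => ((b i : Matrix X X ℚ) * (b j : Matrix X X ℚ)).trace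
  have hG : G.det ≠ 0 := by
    intro h0
    obtain ⟨c, hc, hGc⟩ := Matrix.exists_mulVec_eq_zero_iff.2 h0
    let a : TerwAlg ℚ A x := ∑ j, c j • b j
    have hform (d : TerwAlg ℚ A x) : ((d : Matrix X X ℚ) * (a : Matrix X X ℚ)).trace = 0 := by
      have hi (i) : ((b i : Matrix X X ℚ) * (a : Matrix X X ℚ)).trace = 0 := by
        have := congrFun hGc i
        simpa [G, a, Matrix.mulVec, dotProduct, Matrix.mul_sum, Matrix.trace_sum, mul_comm]
          using this
      rw [← b.sum_repr d, AddSubmonoidClass.coe_finsetSum]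
      simp only [Subalgebra.coe_smul, Matrix.sum_mul, Matrix.smul_mul, Matrix.trace_sum,
        Matrix.trace_smul, hi, smul_zero, Finset.sum_const_zero]
    have ha := hform ⟨_, transpose_mem A x ℚ a.2⟩
    simp only [← Matrix.conjTranspose_eq_transpose_of_trivial,
      Matrix.trace_conjTranspose_mul_self_eq_zero_iff] at ha
    have ha0 : a = 0 := Subtype.ext ha
    exact hc (funext (Fintype.linearIndependent_iff.1 b.linearIndependent c ha0))
  have hspan : y ∈ Submodule.span K (Set.range fun i => extend A x ℚ K (b i)) :=
    span_range_extend_basis A x ℚ K b ▸ Submodule.mem_top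
  obtain ⟨c, hc⟩ := (Submodule.mem_span_range_iff_exists_fun K).1 hspan
  have htr (i) : ((extend A x ℚ K (b i) : Matrix X X K) * (y : Matrix X X K)).trace = 0 := by
    have hn : IsNilpotent (extend A x ℚ K (b i) * y) :=
      IsArtinianRing.isNilpotent_of_mem_jacobson (Ideal.mul_mem_left _ _ hy)
    exact (Matrix.isNilpotent_trace_of_isNilpotent (hn.map (TerwAlg K A x).val)).eq_zero
  have hGc : (G.map (algebraMap ℚ K)).mulVec c = 0 := by
    funext i
    rw [← hc] at htr
    simpa [G, Matrix.mulVec, dotProduct, Matrix.mul_sum, Matrix.trace_sum, mul_comm, coe_extend,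
      ← Matrix.map_mul, AddMonoidHom.map_trace] using htr i
  have hdet : (G.map (algebraMap ℚ K)).det ≠ 0 := by
    rw [← RingHom.mapMatrix_apply, ← RingHom.map_det]
    exact (map_ne_zero _).2 hG
  have hc0 : c = 0 := Matrix.eq_zero_of_mulVec_eq_zero hdet hGc
  rw [Ideal.mem_bot, ← hc, hc0]
  simp

end TerwAlg

/-- If `K` and `K'` are fields of the same characteristic, then
`dim_K KT(x) = dim_{K'} K'T(x)`; moreover `KT(x)` is semisimple iff `K'T(x)` is, so the
semisimplicity of `KT(x)` depends only on the characteristic of the coefficient field. -/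
theorem terwAlg_dim_and_semisimplicity_depend_only_on_char (A : AssocScheme X) (x : X)
    (K K' : Type*) [Field K] [Field K'] (h : ringChar K = ringChar K') :
    Module.finrank K (TerwAlg K A x) = Module.finrank K' (TerwAlg K' A x) ∧
    (IsSemisimpleRing (TerwAlg K A x) ↔ IsSemisimpleRing (TerwAlg K' A x)) := by
  rcases eq_or_ne (ringChar K) 0 with h0 | h0
  · have : CharZero K := (CharP.ringChar_zero_iff_CharZero _).1 h0
    have : CharZero K' := (CharP.ringChar_zero_iff_CharZero _).1 (h ▸ h0)
    exact ⟨(TerwAlg.finrank_eq A x ℚ K).trans (TerwAlg.finrank_eq A x ℚ K').symm,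
      iff_of_true (TerwAlg.isSemisimpleRing_of_charZero A x K)
        (TerwAlg.isSemisimpleRing_of_charZero A x K')⟩
  · have : CharP K' (ringChar K) := ringChar.of_eq h.symm
    have : Fact (ringChar K).Prime := ⟨(CharP.char_is_prime_or_zero K _).resolve_right h0⟩
    let := ZMod.algebra K (ringChar K)
    let := ZMod.algebra K' (ringChar K)
    exact ⟨(TerwAlg.finrank_eq A x (ZMod (ringChar K)) K).trans
      (TerwAlg.finrank_eq A x (ZMod (ringChar K)) K').symm,
      (TerwAlg.isSemisimpleRing_iff A x (ZMod (ringChar K)) K).symm.trans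
        (TerwAlg.isSemisimpleRing_iff A x (ZMod (ringChar K)) K')⟩
end

section
/- Let n ≥ 5 and let (X,S) be the Johnson scheme J(n,2) with fixed point x = {1,2}. Then in M_X(ℤ): ℤT(x) = Σ_{i,j,k} ℤ·E_i*σ_jE_k* + ℤ·(n−4)M, and ℚT(x) ∩ M_X(ℤ) = Σ_{i,j,k} ℤ·E_i*σ_jE_k* + ℤ·M, where the sums run over 0 ≤ i,j,k ≤ 2. -/
open Matrix

/-- The point set of the Johnson scheme `J(n,2)`: 2-element subsets of an `n`-set. -/
abbrev JPoint (n : ℕ) : Type := {A : Finset (Fin n) // A.card = 2}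

/-- The base point `x = {1,2}` (the indices `0` and `1` of `Fin n`). -/
def Jx (n : ℕ) (hn : 2 ≤ n) : JPoint n :=
  ⟨{(⟨0, by omega⟩ : Fin n), (⟨1, by omega⟩ : Fin n)},
    Finset.card_pair (by simp [Fin.ext_iff])⟩

/-- The adjacency matrices `σ₀, σ₁, σ₂` of the relations of `J(n,2)`:
`(y,z) ∈ s₀ ↔ y = z`, `(y,z) ∈ s₁ ↔ |y ∩ z| = 1`, `(y,z) ∈ s₂ ↔ y ∩ z = ∅`. -/
def Jσ (R : Type*) [Zero R] [One R] (n : ℕ) (j : Fin 3) : Matrix (JPoint n) (JPoint n) R :=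
  Matrix.of fun y z =>
    if j = 0 then (if y = z then 1 else 0)
    else if j = 1 then (if (y.1 ∩ z.1).card = 1 then 1 else 0)
    else if y.1 ∩ z.1 = ∅ then 1 else 0

/-- The diagonal matrices `E₀*, E₁*, E₂*` at the base point `x = {1,2}`. -/
def JE (R : Type*) [Zero R] [One R] (n : ℕ) (hn : 2 ≤ n) (i : Fin 3) :
    Matrix (JPoint n) (JPoint n) R :=
  Matrix.diagonal fun y =>
    if i = 0 then (if Jx n hn = y then 1 else 0)
    else if i = 1 then (if ((Jx n hn).1 ∩ y.1).card = 1 then 1 else 0)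
    else if (Jx n hn).1 ∩ y.1 = ∅ then 1 else 0

/-- The matrix `M`: its `(y,z)`-entry is `1` iff `y = {1,i}, z = {2,i}` or
`y = {2,i}, z = {1,i}` for some `i ≥ 3` (indices `0`, `1` and `c ≥ 2` in `Fin n`). -/
def JM (R : Type*) [Zero R] [One R] (n : ℕ) (hn : 2 ≤ n) : Matrix (JPoint n) (JPoint n) R :=
  Matrix.of fun y z =>
    if ∃ c : Fin n, 2 ≤ c.val ∧
        ((y.1 = {⟨0, by omega⟩, c} ∧ z.1 = {⟨1, by omega⟩, c}) ∨
         (y.1 = {⟨1, by omega⟩, c} ∧ z.1 = {⟨0, by omega⟩, c})) then 1 else 0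

/-- The Terwilliger algebra `RT(x)` of the Johnson scheme `J(n,2)` at `x = {1,2}`:
the `R`-subalgebra of `M_X(R)` generated by the matrices `E_i* σ_j E_k*`. -/
def JT (R : Type*) [CommRing R] (n : ℕ) (hn : 2 ≤ n) :
    Subalgebra R (Matrix (JPoint n) (JPoint n) R) :=
  Algebra.adjoin R {m | ∃ i j k : Fin 3, m = JE R n hn i * Jσ R n j * JE R n hn k}

open Finset in
/-- The cardinalities `|A|`, `|A ∩ B|`, `|A ∩ C|`, … of three subsets determine the triple
`(A, B, C)` up to a permutation of the ground set. -/
theorem exists_perm_map_eq {α : Type*} [Fintype α] [DecidableEq α] {A B C A' B' C' : Finset α}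
    (hA : #A = #A') (hB : #B = #B') (hC : #C = #C') (hAB : #(A ∩ B) = #(A' ∩ B'))
    (hAC : #(A ∩ C) = #(A' ∩ C')) (hBC : #(B ∩ C) = #(B' ∩ C'))
    (hABC : #(A ∩ (B ∩ C)) = #(A' ∩ (B' ∩ C'))) :
    ∃ g : Equiv.Perm α, A.map g.toEmbedding = A' ∧ B.map g.toEmbedding = B' ∧
      C.map g.toEmbedding = C' := by
  have split : ∀ S T : Finset α, #S = #(S ∩ T) + #(S \ T) := fun S T => by
    rw [add_comm, card_sdiff_add_card_inter]
  have sdiff_card : ∀ {S T S' T' : Finset α}, #S = #S' → #(S ∩ T) = #(S' ∩ T') →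
      #(S \ T) = #(S' \ T') := by
    intro S T S' T' h₁ h₂
    have := split S T
    have := split S' T'
    omega
  have sdiff_inter : ∀ S T U : Finset α, (S \ T) ∩ U = (S ∩ U) \ T := fun S T U => by
    ext i; simp only [mem_inter, mem_sdiff]; tauto
  have fiber : ∀ c : Bool × Bool × Bool,
      Fintype.card {i // (decide (i ∈ A), decide (i ∈ B), decide (i ∈ C)) = c} =
        Fintype.card {i // (decide (i ∈ A'), decide (i ∈ B'), decide (i ∈ C')) = c} := by
    have h110 : #((A ∩ B) \ C) = #((A' ∩ B') \ C') :=
      sdiff_card hAB (by simpa [inter_assoc] using hABC)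
    have h101 : #((A ∩ C) \ B) = #((A' ∩ C') \ B') :=
      sdiff_card hAC (by simpa [inter_assoc, inter_comm C, inter_comm C'] using hABC)
    have h011 : #((B ∩ C) \ A) = #((B' ∩ C') \ A') :=
      sdiff_card hBC (by simpa [inter_comm _ A, inter_comm _ A'] using hABC)
    have h100 : #((A \ B) \ C) = #((A' \ B') \ C') :=
      sdiff_card (sdiff_card hA hAB) (by simpa only [sdiff_inter] using h101)
    have h010 : #((B \ A) \ C) = #((B' \ A') \ C') :=
      sdiff_card (sdiff_card hB (by simpa only [inter_comm] using hAB))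
        (by simpa only [sdiff_inter] using h011)
    have h001 : #((C \ A) \ B) = #((C' \ A') \ B') :=
      sdiff_card (sdiff_card hC (by simpa only [inter_comm] using hAC))
        (by simpa only [sdiff_inter, inter_comm C, inter_comm C'] using h011)
    have h01 : #(Aᶜ \ B) = #(A'ᶜ \ B') :=
      sdiff_card (by simp only [card_compl, hA])
        (by simpa only [inter_comm Aᶜ, inter_comm A'ᶜ, ← sdiff_eq_inter_compl] using
          sdiff_card hB (by simpa only [inter_comm] using hAB))
    have h000 : #((Aᶜ \ B) \ C) = #((A'ᶜ \ B') \ C') := by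
      refine sdiff_card h01 ?_
      have e : ∀ S T U : Finset α, (Sᶜ \ T) ∩ U = (U \ S) \ T := fun S T U => by
        ext i; simp only [mem_inter, mem_sdiff, mem_compl]; tauto
      rw [e, e, h001]
    rintro ⟨p, q, r⟩
    rw [Fintype.card_subtype, Fintype.card_subtype]
    cases p <;> cases q <;> cases r
    · convert h000 using 2 <;> ext <;> simp <;> tauto
    · convert h001 using 2 <;> ext <;> simp <;> tauto
    · convert h010 using 2 <;> ext <;> simp <;> tauto
    · convert h011 using 2 <;> ext <;> simp <;> tauto
    · convert h100 using 2 <;> ext <;> simp <;> tauto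
    · convert h101 using 2 <;> ext <;> simp <;> tauto
    · convert h110 using 2 <;> ext <;> simp <;> tauto
    · convert hABC using 2 <;> ext <;> simp
  have e : ∀ c, Nonempty _ := fun c => ⟨Fintype.equivOfCardEq (fiber c)⟩
  let g : Equiv.Perm α := Equiv.ofFiberEquiv fun c => (e c).some
  have hg : ∀ i, (decide (g i ∈ A'), decide (g i ∈ B'), decide (g i ∈ C')) =
      (decide (i ∈ A), decide (i ∈ B), decide (i ∈ C)) := fun i =>
    Equiv.ofFiberEquiv_map (g := fun i => (decide (i ∈ A'), decide (i ∈ B'), decide (i ∈ C')))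
      (fun c => (e c).some) i
  simp only [Prod.mk.injEq, decide_eq_decide] at hg
  have key : ∀ S S' : Finset α, (∀ i, g i ∈ S' ↔ i ∈ S) → S.map g.toEmbedding = S' := by
    intro S S' h
    ext i
    rw [mem_map_equiv, ← h, Equiv.apply_symm_apply]
  exact ⟨g, key _ _ fun i => (hg i).1, key _ _ fun i => (hg i).2.1, key _ _ fun i => (hg i).2.2⟩

/-- The action of a permutation of `Fin n` on the points of `J(n,2)`. -/
def JPoint.permEquiv {n : ℕ} (g : Equiv.Perm (Fin n)) : JPoint n ≃ JPoint n :=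
  g.finsetCongr.subtypeEquiv fun A => by simp

/-- The centralizer algebra of the stabilizer of the base point `x`. -/
def invariantSubalgebra (R : Type*) [CommRing R] (n : ℕ) (hn : 2 ≤ n) :
    Subalgebra R (Matrix (JPoint n) (JPoint n) R) where
  carrier := {m | ∀ g : Equiv.Perm (Fin n), JPoint.permEquiv g (Jx n hn) = Jx n hn →
    m.submatrix (JPoint.permEquiv g) (JPoint.permEquiv g) = m}
  mul_mem' {a b} ha hb g hg := by
    rw [← Matrix.submatrix_mul_equiv a b _ (JPoint.permEquiv g) _, ha g hg, hb g hg]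
  add_mem' {a b} ha hb g hg := by
    rw [Matrix.submatrix_add, Pi.add_apply, Pi.add_apply, ha g hg, hb g hg]
  algebraMap_mem' r g _ := by
    rw [Matrix.algebraMap_eq_diagonal, Matrix.submatrix_diagonal_equiv]
    rfl

/-- The matrix whose `(y,z)`-entry is a given function of `|x ∩ y|`, `|x ∩ z|`, `|y ∩ z|`
and `|x ∩ y ∩ z|`. -/
def orbitMatrix {R : Type*} (n : ℕ) (hn : 2 ≤ n) (f : ℕ → ℕ → ℕ → ℕ → R) :
    Matrix (JPoint n) (JPoint n) R :=
  Matrix.of fun y z => f ((Jx n hn).1 ∩ y.1).card ((Jx n hn).1 ∩ z.1).card (y.1 ∩ z.1).card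
    ((Jx n hn).1 ∩ (y.1 ∩ z.1)).card

theorem mem_invariantSubalgebra_iff {R : Type*} [CommRing R] {n : ℕ} (hn : 2 ≤ n)
    {m : Matrix (JPoint n) (JPoint n) R} :
    m ∈ invariantSubalgebra R n hn ↔ ∃ f, m = orbitMatrix n hn f := by
  constructor
  · intro hm
    let τ : JPoint n × JPoint n → ℕ × ℕ × ℕ × ℕ := fun p =>
      (((Jx n hn).1 ∩ p.1.1).card, ((Jx n hn).1 ∩ p.2.1).card, (p.1.1 ∩ p.2.1).card,
        ((Jx n hn).1 ∩ (p.1.1 ∩ p.2.1)).card)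
    have hτ : Function.FactorsThrough (fun p : JPoint n × JPoint n => m p.1 p.2) τ := by
      rintro ⟨y, z⟩ ⟨y', z'⟩ h
      simp only [τ, Prod.mk.injEq] at h
      obtain ⟨g, hx, hy, hz⟩ := exists_perm_map_eq (A := (Jx n hn).1) rfl
        (y.2.trans y'.2.symm) (z.2.trans z'.2.symm) h.1 h.2.1 h.2.2.1 h.2.2.2
      have hg := congrFun₂ (hm g (Subtype.ext hx)) y z
      have hy' : JPoint.permEquiv g y = y' := Subtype.ext hy
      have hz' : JPoint.permEquiv g z = z' := Subtype.ext hz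
      rw [Matrix.submatrix_apply, hy', hz'] at hg
      exact hg.symm
    refine ⟨fun a b c d => Function.extend τ (fun p => m p.1 p.2) 0 (a, b, c, d), ?_⟩
    ext y z
    exact (hτ.extend_apply 0 (y, z)).symm
  · rintro ⟨f, rfl⟩ g hg
    have hx : (Jx n hn).1.map g.toEmbedding = (Jx n hn).1 := congrArg Subtype.val hg
    ext y z
    have e : ∀ w : JPoint n, (JPoint.permEquiv g w).1 = w.1.map g.toEmbedding := fun _ => rfl
    simp only [orbitMatrix, Matrix.submatrix_apply, Matrix.of_apply, e]
    have k : ∀ s : Finset (Fin n), ((Jx n hn).1 ∩ s.map g.toEmbedding).card =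
        ((Jx n hn).1 ∩ s).card := fun s => by
      rw [← Finset.card_map g.toEmbedding (s := (Jx n hn).1 ∩ s), Finset.map_inter, hx]
    simp only [← Finset.map_inter, Finset.card_map, k]

theorem JPoint.inter_card_le {n : ℕ} (y z : JPoint n) : (y.1 ∩ z.1).card ≤ 2 :=
  (Finset.card_le_card Finset.inter_subset_left).trans y.2.le

theorem JPoint.eq_iff_inter_card {n : ℕ} {y z : JPoint n} : y = z ↔ (y.1 ∩ z.1).card = 2 := by
  constructor
  · rintro rfl
    rw [Finset.inter_self, y.2]
  · intro h
    have hy : y.1 ∩ z.1 = y.1 := Finset.eq_of_subset_of_card_le Finset.inter_subset_left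
      (by rw [h, y.2])
    have hz : y.1 ∩ z.1 = z.1 := Finset.eq_of_subset_of_card_le Finset.inter_subset_right
      (by rw [h, z.2])
    exact Subtype.ext (hy.symm.trans hz)

theorem JE_mul_Jσ_mul_JE (R : Type*) [CommRing R] {n : ℕ} (hn : 2 ≤ n) (i j k : Fin 3) :
    JE R n hn i * Jσ R n j * JE R n hn k = orbitMatrix n hn fun a b c _ =>
      if a + i.val = 2 ∧ c + j.val = 2 ∧ b + k.val = 2 then 1 else 0 := by
  have rel : ∀ (l : Fin 3) (y z : JPoint n),
      (if l = 0 then (if y = z then (1 : R) else 0)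
        else if l = 1 then (if (y.1 ∩ z.1).card = 1 then 1 else 0)
        else if y.1 ∩ z.1 = ∅ then 1 else 0) =
      if (y.1 ∩ z.1).card + l.val = 2 then 1 else 0 := by
    intro l y z
    fin_cases l
    · simp [JPoint.eq_iff_inter_card]
    · simp
    · simp
  ext y z
  simp only [JE, Jσ, orbitMatrix, Matrix.mul_diagonal, Matrix.diagonal_mul, Matrix.of_apply, rel]
  split_ifs <;> simp_all

theorem card_pair_inter {α : Type*} [DecidableEq α] {i j : α} (h : i ≠ j) (s : Finset α) :
    (({i, j} : Finset α) ∩ s).card = (if i ∈ s then 1 else 0) + if j ∈ s then 1 else 0 := by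
  by_cases hi : i ∈ s <;> by_cases hj : j ∈ s <;>
    simp [Finset.insert_inter_of_mem, Finset.insert_inter_of_notMem,
      Finset.singleton_inter_of_mem, Finset.singleton_inter_of_notMem, hi, hj, h]

theorem JM_eq_orbitMatrix (R : Type*) [CommRing R] {n : ℕ} (hn : 2 ≤ n) :
    JM R n hn = orbitMatrix n hn fun a b c d =>
      if a = 1 ∧ b = 1 ∧ c = 1 ∧ d = 0 then 1 else 0 := by
  ext y z
  simp only [JM, orbitMatrix, Matrix.of_apply]
  refine if_congr ?_ rfl rfl
  have h01 : (⟨0, by omega⟩ : Fin n) ≠ ⟨1, by omega⟩ := by simp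
  simp only [Jx, card_pair_inter h01]
  obtain ⟨y, hy⟩ := y
  obtain ⟨z, hz⟩ := z
  dsimp only
  constructor
  · have pos : 0 < n := Nat.zero_lt_of_lt hn
    rintro ⟨c, hc, ⟨hy', hz'⟩ | ⟨hy', hz'⟩⟩
    · have h0 : (⟨0, by omega⟩ : Fin n) ≠ c := fun h => by simp [← h] at hc
      have h1 : (⟨1, by omega⟩ : Fin n) ≠ c := fun h => by simp [← h] at hc
      replace hy' : y = {⟨0, pos⟩, c} := hy'
      replace hz' : z = {⟨1, hn⟩, c} := hz'
      subst hy' hz'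
      rw [card_pair_inter h0]
      simp [h0, h1]
    · have h0 : (⟨0, by omega⟩ : Fin n) ≠ c := fun h => by simp [← h] at hc
      have h1 : (⟨1, by omega⟩ : Fin n) ≠ c := fun h => by simp [← h] at hc
      replace hy' : y = {⟨1, hn⟩, c} := hy'
      replace hz' : z = {⟨0, pos⟩, c} := hz'
      subst hy' hz'
      rw [card_pair_inter h1]
      simp [h0, h1]
  · rintro ⟨hxy, hxz, hyz, hxyz⟩
    obtain ⟨c, hc⟩ := Finset.card_eq_one.1 hyz
    have hcy : c ∈ y ∧ c ∈ z := by rw [← Finset.mem_inter, hc, Finset.mem_singleton]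
    have hc0 : c ≠ ⟨0, by omega⟩ := by rintro rfl; simp [hcy] at hxyz
    have hc1 : c ≠ ⟨1, by omega⟩ := by rintro rfl; simp [hcy] at hxyz
    have pair : ∀ {s : Finset (Fin n)} {i : Fin n}, s.card = 2 → i ≠ c → i ∈ s → c ∈ s →
        s = {i, c} := fun hs hi h h' => (Finset.eq_of_subset_of_card_le
          (by simp [Finset.insert_subset_iff, h, h']) (by rw [hs, Finset.card_pair hi])).symm
    refine ⟨c, ?_, ?_⟩
    · simp only [ne_eq, Fin.ext_iff] at hc0 hc1
      omega
    · simp only [Finset.mem_inter] at hxyz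
      by_cases h0y : (⟨0, by omega⟩ : Fin n) ∈ y <;> by_cases h1y : (⟨1, by omega⟩ : Fin n) ∈ y <;>
        by_cases h0z : (⟨0, by omega⟩ : Fin n) ∈ z <;>
        by_cases h1z : (⟨1, by omega⟩ : Fin n) ∈ z <;> simp [h0y, h1y, h0z, h1z] at hxy hxz hxyz
      · exact Or.inl ⟨pair hy hc0.symm h0y hcy.1, pair hz hc1.symm h1z hcy.2⟩
      · exact Or.inr ⟨pair hy hc1.symm h1y hcy.1, pair hz hc0.symm h0z hcy.2⟩

/-- The point `{i, j}` of `J(n,2)`. -/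
def JPoint.pair {n : ℕ} (i j : ℕ) (hij : i < j) (hj : j < n) : JPoint n :=
  ⟨{⟨i, hij.trans hj⟩, ⟨j, hj⟩}, Finset.card_pair (by simp [hij.ne])⟩

/-- The value of `m` at `({1,3}, {1,4})` minus the value at `({1,3}, {2,3})`. -/
def discrepancy {R : Type*} [CommRing R] {n : ℕ} (hn : 4 ≤ n)
    (m : Matrix (JPoint n) (JPoint n) R) : R :=
  m (.pair 0 2 (by omega) (by omega)) (.pair 0 3 (by omega) (by omega)) -
    m (.pair 0 2 (by omega) (by omega)) (.pair 1 2 (by omega) (by omega))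

theorem discrepancy_orbitMatrix {R : Type*} [CommRing R] {n : ℕ} (hn : 4 ≤ n)
    (f : ℕ → ℕ → ℕ → ℕ → R) :
    discrepancy hn (orbitMatrix n (by omega) f) = f 1 1 1 1 - f 1 1 1 0 := by
  simp [discrepancy, orbitMatrix, Jx, JPoint.pair, card_pair_inter]

theorem sum_fin_split {M : Type*} [AddCommMonoid M] {n : ℕ} (hn : 4 ≤ n) (h : Fin n → M) :
    ∑ i, h i = h ⟨0, by omega⟩ + (h ⟨1, by omega⟩ + (h ⟨2, by omega⟩ + (h ⟨3, by omega⟩ +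
      ∑ c : Fin (n - 4), h ⟨c + 4, by omega⟩))) := by
  obtain ⟨k, rfl⟩ := Nat.exists_eq_add_of_le' hn
  rw [Fin.sum_univ_succ, Fin.sum_univ_succ, Fin.sum_univ_succ, Fin.sum_univ_succ]
  rfl

theorem sum_JPoint {M : Type*} [AddCommMonoid M] {n : ℕ} (F : JPoint n → M) :
    ∑ z, F z = ∑ i : Fin n, ∑ j : Fin n, if h : i < j then F (.pair i j h j.2) else 0 := by
  rw [← Finset.sum_product', Finset.univ_product_univ, Finset.sum_dite, Finset.sum_const_zero,
    add_zero]
  symm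
  refine Finset.sum_bij (fun p _ => .pair p.1.1 p.1.2 (Finset.mem_filter.1 p.2).2 p.1.2.2)
    (fun _ _ => Finset.mem_univ _) ?_ ?_ (fun _ _ => rfl)
  · rintro ⟨⟨i, j⟩, hp⟩ - ⟨⟨i', j'⟩, hq⟩ - h
    simp only [Finset.mem_filter, Finset.mem_univ, true_and] at hp hq
    have h' : ({i, j} : Finset (Fin n)) = {i', j'} := congrArg Subtype.val h
    have hi : i ∈ ({i', j'} : Finset (Fin n)) := h' ▸ by simp
    have hj : j ∈ ({i', j'} : Finset (Fin n)) := h' ▸ by simp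
    simp only [Finset.mem_insert, Finset.mem_singleton] at hi hj
    grind
  · rintro ⟨z, hz⟩ -
    obtain ⟨i, j, hij, rfl⟩ := Finset.card_eq_two.1 hz
    rcases hij.lt_or_gt with h | h
    · exact ⟨⟨(i, j), by simp [h]⟩, Finset.mem_attach _ _, rfl⟩
    · exact ⟨⟨(j, i), by simp [h]⟩, Finset.mem_attach _ _, Subtype.ext (Finset.pair_comm j i)⟩

theorem sum_JPoint_split {M : Type*} [AddCommMonoid M] {n : ℕ} (hn : 4 ≤ n)
    (F : JPoint n → M) :
    ∑ z, F z = F (.pair 0 1 (by omega) (by omega)) + F (.pair 0 2 (by omega) (by omega)) +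
      F (.pair 0 3 (by omega) (by omega)) + F (.pair 1 2 (by omega) (by omega)) +
      F (.pair 1 3 (by omega) (by omega)) + F (.pair 2 3 (by omega) (by omega)) +
      ∑ c : Fin (n - 4), F (.pair 0 (c + 4) (by omega) (by omega)) +
      ∑ c : Fin (n - 4), F (.pair 1 (c + 4) (by omega) (by omega)) +
      ∑ c : Fin (n - 4), F (.pair 2 (c + 4) (by omega) (by omega)) +
      ∑ c : Fin (n - 4), F (.pair 3 (c + 4) (by omega) (by omega)) +
      ∑ c : Fin (n - 4), ∑ d : Fin (n - 4), if h : c < d then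
        F (.pair (c + 4) (d + 4) (by simpa using h) (by omega)) else 0 := by
  simp only [sum_JPoint, sum_fin_split hn]
  have h3 : ∀ c : ℕ, ¬c + 4 < 3 := by omega
  simp [h3]
  ac_rfl

theorem discrepancy_mul {R : Type*} [CommRing R] {n : ℕ} (hn : 4 ≤ n)
    (f f' : ℕ → ℕ → ℕ → ℕ → R) :
    discrepancy hn (orbitMatrix n (by omega) f * orbitMatrix n (by omega) f') =
      ((n : R) - 4) * ((f 1 1 1 1 - f 1 1 0 0) * (f' 1 1 1 1 - f' 1 1 0 0) -
        (f 1 0 1 0 - f 1 0 0 0) * (f' 0 1 1 0 - f' 0 1 0 0)) +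
      (f 1 1 2 1 - f 1 1 0 0) * discrepancy hn (orbitMatrix n (by omega) f') +
      discrepancy hn (orbitMatrix n (by omega) f) * (f' 1 1 2 1 - f' 1 1 0 0) := by
  have hc : ((n - 4 : ℕ) : R) = (n : R) - 4 := by rw [Nat.cast_sub hn]; norm_num
  rw [discrepancy_orbitMatrix, discrepancy_orbitMatrix]
  simp only [discrepancy, Matrix.mul_apply, sum_JPoint_split hn]
  simp [orbitMatrix, Jx, JPoint.pair, card_pair_inter, hc]
  ring

theorem orbitMatrix_eq_sum {R : Type*} [CommRing R] {n : ℕ} (hn : 4 ≤ n)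
    (f : ℕ → ℕ → ℕ → ℕ → R) :
    orbitMatrix n (by omega) f =
      ∑ i : Fin 3, ∑ j : Fin 3, ∑ k : Fin 3,
        f (2 - i) (2 - k) (2 - j) (min (2 - i) (min (2 - k) (2 - j))) •
          (JE R n (by omega) i * Jσ R n j * JE R n (by omega) k) -
      discrepancy hn (orbitMatrix n (by omega) f) • JM R n (by omega) := by
  rw [discrepancy_orbitMatrix, JM_eq_orbitMatrix]
  simp only [JE_mul_Jσ_mul_JE]
  ext y z
  simp only [orbitMatrix, Matrix.sub_apply, Matrix.sum_apply, Matrix.smul_apply, Matrix.of_apply,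
    smul_eq_mul]
  have hxy := JPoint.inter_card_le (Jx n (by omega)) y
  have hxz := JPoint.inter_card_le (Jx n (by omega)) z
  have hyz := JPoint.inter_card_le y z
  have exy := JPoint.eq_iff_inter_card (y := Jx n (by omega)) (z := y)
  have exz := JPoint.eq_iff_inter_card (y := Jx n (by omega)) (z := z)
  have eyz := JPoint.eq_iff_inter_card (y := y) (z := z)
  have lxy : ((Jx n (by omega)).1 ∩ (y.1 ∩ z.1)).card ≤ ((Jx n (by omega)).1 ∩ y.1).card :=
    Finset.card_le_card (Finset.inter_subset_inter_left Finset.inter_subset_left)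
  have lxz : ((Jx n (by omega)).1 ∩ (y.1 ∩ z.1)).card ≤ ((Jx n (by omega)).1 ∩ z.1).card :=
    Finset.card_le_card (Finset.inter_subset_inter_left Finset.inter_subset_right)
  have lyz : ((Jx n (by omega)).1 ∩ (y.1 ∩ z.1)).card ≤ (y.1 ∩ z.1).card :=
    Finset.card_le_card Finset.inter_subset_right
  have dxy : ((Jx n (by omega)).1 ∩ y.1).card = 2 →
      ((Jx n (by omega)).1 ∩ (y.1 ∩ z.1)).card = (y.1 ∩ z.1).card := fun h => by
    rw [exy.2 h, ← Finset.inter_assoc, Finset.inter_self]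
  have dxz : ((Jx n (by omega)).1 ∩ z.1).card = 2 →
      ((Jx n (by omega)).1 ∩ (y.1 ∩ z.1)).card = (y.1 ∩ z.1).card := fun h => by
    rw [exz.2 h, Finset.inter_left_comm, Finset.inter_self]
  have dyz : (y.1 ∩ z.1).card = 2 →
      ((Jx n (by omega)).1 ∩ (y.1 ∩ z.1)).card = ((Jx n (by omega)).1 ∩ y.1).card := fun h => by
    rw [eyz.2 h, Finset.inter_self]
  have dyz' : (y.1 ∩ z.1).card = 2 →
      ((Jx n (by omega)).1 ∩ (y.1 ∩ z.1)).card = ((Jx n (by omega)).1 ∩ z.1).card := fun h => by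
    rw [eyz.2 h, Finset.inter_self]
  clear exy exz eyz
  generalize ((Jx n (by omega)).1 ∩ (y.1 ∩ z.1)).card = d at *
  generalize ((Jx n (by omega)).1 ∩ y.1).card = a at *
  generalize ((Jx n (by omega)).1 ∩ z.1).card = b at *
  generalize (y.1 ∩ z.1).card = c at *
  have hd : (a = 1 ∧ b = 1 ∧ c = 1 ∧ d = 0) ∨ d = min a (min b c) := by omega
  have main : (∑ i : Fin 3, ∑ j : Fin 3, ∑ k : Fin 3,
      f (2 - i) (2 - k) (2 - j) (min (2 - i) (min (2 - k) (2 - j))) *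
        if a + i.val = 2 ∧ c + j.val = 2 ∧ b + k.val = 2 then (1 : R) else 0) =
      f a b c (min a (min b c)) := by
    clear dxy dxz dyz dyz' lxy lxz lyz hd
    interval_cases a <;> interval_cases b <;> interval_cases c <;> simp [Fin.sum_univ_three]
  rw [main]
  rcases hd with ⟨rfl, rfl, rfl, rfl⟩ | rfl
  · simp
  · rw [if_neg (by omega)]
    simp

/-- The matrices `E_i* σ_j E_k*`. -/
abbrev JGen (R : Type*) [CommRing R] (n : ℕ) (hn : 2 ≤ n) :
    Set (Matrix (JPoint n) (JPoint n) R) :=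
  {m | ∃ i j k : Fin 3, m = JE R n hn i * Jσ R n j * JE R n hn k}

theorem add_discrepancy_smul_JM_mem_span {R : Type*} [CommRing R] {n : ℕ} (hn : 4 ≤ n)
    {m : Matrix (JPoint n) (JPoint n) R} (hm : m ∈ invariantSubalgebra R n (by omega)) :
    m + discrepancy hn m • JM R n (by omega) ∈ Submodule.span R (JGen R n (by omega)) := by
  obtain ⟨f, rfl⟩ := (mem_invariantSubalgebra_iff _).1 hm
  rw [eq_sub_iff_add_eq.1 (orbitMatrix_eq_sum hn f)]
  exact Submodule.sum_mem _ fun i _ => Submodule.sum_mem _ fun j _ => Submodule.sum_mem _ fun k _ =>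
    Submodule.smul_mem _ _ (Submodule.subset_span ⟨i, j, k, rfl⟩)

theorem mem_invariantSubalgebra_of_mem_JGen {R : Type*} [CommRing R] {n : ℕ} {hn : 2 ≤ n}
    {m : Matrix (JPoint n) (JPoint n) R} (hm : m ∈ JGen R n hn) :
    m ∈ invariantSubalgebra R n hn := by
  obtain ⟨i, j, k, rfl⟩ := hm
  exact (mem_invariantSubalgebra_iff hn).2 ⟨_, JE_mul_Jσ_mul_JE R hn i j k⟩

theorem JT_le_invariantSubalgebra (R : Type*) [CommRing R] {n : ℕ} (hn : 2 ≤ n) :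
    JT R n hn ≤ invariantSubalgebra R n hn :=
  Algebra.adjoin_le fun _ => mem_invariantSubalgebra_of_mem_JGen

theorem span_JGen_le_JT (R : Type*) [CommRing R] {n : ℕ} (hn : 2 ≤ n) :
    Submodule.span R (JGen R n hn) ≤ Subalgebra.toSubmodule (JT R n hn) :=
  Algebra.span_le_adjoin R _

theorem dvd_discrepancy_of_mem_JT {R : Type*} [CommRing R] {n : ℕ} (hn : 4 ≤ n)
    {m : Matrix (JPoint n) (JPoint n) R} (hm : m ∈ JT R n (by omega)) :
    (n : R) - 4 ∣ discrepancy hn m := by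
  induction hm using Algebra.adjoin_induction with
  | mem m h =>
    obtain ⟨i, j, k, rfl⟩ := h
    rw [JE_mul_Jσ_mul_JE, discrepancy_orbitMatrix, sub_self]
    exact dvd_zero _
  | algebraMap r =>
    rw [discrepancy, Matrix.algebraMap_matrix_apply, Matrix.algebraMap_matrix_apply, if_neg, if_neg,
      sub_self]
    · exact dvd_zero _
    all_goals
      intro h
      simpa [JPoint.pair, card_pair_inter] using JPoint.eq_iff_inter_card.1 h
  | add a b _ _ ha hb =>
    have : discrepancy hn (a + b) = discrepancy hn a + discrepancy hn b := by
      simp only [discrepancy, Matrix.add_apply]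
      ring
    exact this ▸ dvd_add ha hb
  | mul a b ha' hb' ha hb =>
    obtain ⟨f, rfl⟩ := (mem_invariantSubalgebra_iff _).1 (JT_le_invariantSubalgebra R _ ha')
    obtain ⟨f', rfl⟩ := (mem_invariantSubalgebra_iff _).1 (JT_le_invariantSubalgebra R _ hb')
    rw [discrepancy_mul]
    exact dvd_add (dvd_add (dvd_mul_right _ _) (hb.mul_left _)) (ha.mul_right _)

theorem smul_JM_mem_JT (R : Type*) [CommRing R] {n : ℕ} (hn : 4 ≤ n) :
    ((n : R) - 4) • JM R n (by omega) ∈ JT R n (by omega) := by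
  set A := JE R n (by omega) 1 * Jσ R n 1 * JE R n (by omega) 1 with hA
  have hAT : A * A ∈ JT R n (by omega) :=
    mul_mem (Algebra.subset_adjoin ⟨1, 1, 1, rfl⟩) (Algebra.subset_adjoin ⟨1, 1, 1, rfl⟩)
  have hD : discrepancy hn (A * A) = (n : R) - 4 := by
    rw [hA, JE_mul_Jσ_mul_JE, discrepancy_mul, discrepancy_orbitMatrix]
    simp
  have h := span_JGen_le_JT R _
    (add_discrepancy_smul_JM_mem_span hn (JT_le_invariantSubalgebra R _ hAT))
  rw [hD] at h
  simpa using sub_mem h hAT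

theorem map_intCast_orbitMatrix {n : ℕ} (hn : 2 ≤ n) (f : ℕ → ℕ → ℕ → ℕ → ℤ) :
    (orbitMatrix n hn f).map (Int.cast : ℤ → ℚ) =
      orbitMatrix n hn fun a b c d => (f a b c d : ℚ) :=
  rfl

/-- **Theorem.** For `J(n,2)` (`n ≥ 5`) with base point `x = {1,2}`:
`ℤT(x) = Σ_{i,j,k} ℤ·E_i*σ_jE_k* + ℤ·(n−4)M` and
`ℚT(x) ∩ M_X(ℤ) = Σ_{i,j,k} ℤ·E_i*σ_jE_k* + ℤ·M`. -/
theorem johnson_ZT_and_lattice (n : ℕ) (hn : 5 ≤ n) :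
    Subalgebra.toSubmodule (JT ℤ n (by omega)) =
      Submodule.span ℤ
        ({m | ∃ i j k : Fin 3, m = JE ℤ n (by omega) i * Jσ ℤ n j * JE ℤ n (by omega) k} ∪
          {((n : ℤ) - 4) • JM ℤ n (by omega)}) ∧
    {m : Matrix (JPoint n) (JPoint n) ℤ | m.map (Int.cast : ℤ → ℚ) ∈ JT ℚ n (by omega)} =
      (Submodule.span ℤ
        ({m | ∃ i j k : Fin 3, m = JE ℤ n (by omega) i * Jσ ℤ n j * JE ℤ n (by omega) k} ∪
          {JM ℤ n (by omega)}) : Set (Matrix (JPoint n) (JPoint n) ℤ)) := by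

  have h2 : 2 ≤ n := by omega
  have h4 : 4 ≤ n := by omega
  have smul_JM : ∀ {s : Set (Matrix (JPoint n) (JPoint n) ℤ)} {m : Matrix (JPoint n) (JPoint n) ℤ},
      m ∈ invariantSubalgebra ℤ n h2 →
      discrepancy h4 m • JM ℤ n h2 ∈ Submodule.span ℤ (JGen ℤ n h2 ∪ s) →
      m ∈ Submodule.span ℤ (JGen ℤ n h2 ∪ s) := fun hm h => by
    simpa using sub_mem (Submodule.span_mono Set.subset_union_left
      (add_discrepancy_smul_JM_mem_span h4 hm)) h
  constructor
  · apply le_antisymm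
    · intro m hm
      refine smul_JM (JT_le_invariantSubalgebra ℤ h2 hm) ?_
      obtain ⟨q, hq⟩ := dvd_discrepancy_of_mem_JT h4 hm
      rw [hq, mul_comm, mul_smul]
      exact Submodule.smul_mem _ _ (Submodule.subset_span (Or.inr rfl))
    · refine Submodule.span_le.2 (Set.union_subset Algebra.subset_adjoin ?_)
      rw [Set.singleton_subset_iff]
      exact_mod_cast smul_JM_mem_JT ℤ h4
  · apply Set.Subset.antisymm
    · intro m hm
      refine smul_JM (fun g hg => ?_)
        (Submodule.smul_mem _ _ (Submodule.subset_span (Or.inr rfl)))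
      have := JT_le_invariantSubalgebra ℚ h2 hm g hg
      rw [Matrix.submatrix_map] at this
      exact Matrix.map_injective Int.cast_injective this
    · let φ := (Int.castRingHom ℚ).mapMatrix (m := JPoint n)
      have hφ : Submodule.span ℤ (JGen ℤ n h2 ∪ {JM ℤ n h2}) ≤
          AddSubgroup.toIntSubmodule
            ((Subalgebra.toSubmodule (JT ℚ n h2)).toAddSubgroup.comap φ.toAddMonoidHom) := by
        refine Submodule.span_le.2 (Set.union_subset ?_ ?_)
        · rintro _ ⟨i, j, k, rfl⟩
          have : φ (JE ℤ n h2 i * Jσ ℤ n j * JE ℤ n h2 k) =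
              JE ℚ n h2 i * Jσ ℚ n j * JE ℚ n h2 k := by
            rw [JE_mul_Jσ_mul_JE, JE_mul_Jσ_mul_JE]
            exact (map_intCast_orbitMatrix h2 _).trans (by simp)
          change φ _ ∈ JT ℚ n h2
          rw [this]
          exact Algebra.subset_adjoin ⟨i, j, k, rfl⟩
        · rw [Set.singleton_subset_iff]
          have : φ (JM ℤ n h2) = JM ℚ n h2 := by
            rw [JM_eq_orbitMatrix, JM_eq_orbitMatrix]
            exact (map_intCast_orbitMatrix h2 _).trans (by simp)
          have hn0 : (n : ℚ) - 4 ≠ 0 := by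
            rw [sub_ne_zero]
            exact_mod_cast (show n ≠ 4 by omega)
          have hM := Subalgebra.smul_mem _ (smul_JM_mem_JT ℚ h4) ((n : ℚ) - 4)⁻¹
          rw [inv_smul_smul₀ hn0] at hM
          change φ _ ∈ JT ℚ n h2
          rwa [this]
      exact hφ
end

section
/- Let n ≥ 6 and let (X,S) be the Johnson scheme J(n,2) with fixed point x = {1,2}. Then ℤT(x) is a proper subset of ℚT(x) ∩ M_X(ℤ); specifically, the matrix M belongs to ℚT(x) ∩ M_X(ℤ) but not to ℤT(x). (This gives a negative answer to a question of Terwilliger asking whether ℤT(x) is always generated by the matrices E_i*σ_jE_k*, i.e., whether ℤT(x) = ℚT(x) ∩ M_X(ℤ).) -/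
open Matrix

open Finset in
lemma exists_perm_map_eq_s13 {α : Type*} [Fintype α] [DecidableEq α] {x y z x' y' z' : Finset α}
    (hx : #x = #x') (hy : #y = #y') (hz : #z = #z')
    (hxy : #(x ∩ y) = #(x' ∩ y')) (hxz : #(x ∩ z) = #(x' ∩ z')) (hyz : #(y ∩ z) = #(y' ∩ z'))
    (hxyz : #(x ∩ y ∩ z) = #(x' ∩ y' ∩ z')) :
    ∃ e : Equiv.Perm α, x.map e.toEmbedding = x' ∧ y.map e.toEmbedding = y' ∧
      z.map e.toEmbedding = z' := by
  let d (x y z : Finset α) (p : α) : Bool × Bool × Bool :=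
    (decide (p ∈ x), decide (p ∈ y), decide (p ∈ z))
  have key (b : Bool × Bool × Bool) : #{p | d x y z p = b} = #{p | d x' y' z' p = b} := by
    have split (A B : Finset α) : #(A ∩ B) + #(A ∩ Bᶜ) = #A := by
      rw [← sdiff_eq_inter_compl, card_inter_add_card_sdiff]
    have count (x y z : Finset α) (b : Bool × Bool × Bool) :
        #{p | d x y z p = b} = #((if b.1 then x else xᶜ) ∩ (if b.2.1 then y else yᶜ) ∩
          (if b.2.2 then z else zᶜ)) := by
      congr 1
      ext p
      obtain ⟨_ | _, _ | _, _ | _⟩ := b <;> simp [d]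
    have cards (x y z : Finset α) :
        #(x ∩ y ∩ z) + #(x ∩ y ∩ zᶜ) = #(x ∩ y) ∧
        #(x ∩ y ∩ z) + #(x ∩ yᶜ ∩ z) = #(x ∩ z) ∧
        #(x ∩ y ∩ z) + #(xᶜ ∩ y ∩ z) = #(y ∩ z) ∧
        #(x ∩ y) + (#(x ∩ yᶜ ∩ z) + #(x ∩ yᶜ ∩ zᶜ)) = #x ∧
        #(x ∩ y) + (#(xᶜ ∩ y ∩ z) + #(xᶜ ∩ y ∩ zᶜ)) = #y ∧
        #(x ∩ z) + (#(xᶜ ∩ y ∩ z) + #(xᶜ ∩ yᶜ ∩ z)) = #z ∧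
        #x + (#(xᶜ ∩ y ∩ z) + #(xᶜ ∩ y ∩ zᶜ) + (#(xᶜ ∩ yᶜ ∩ z) + #(xᶜ ∩ yᶜ ∩ zᶜ))) =
          Fintype.card α := by
      refine ⟨split _ _, ?_, ?_, ?_, ?_, ?_, ?_⟩
      · rw [← split (x ∩ z) y, inter_right_comm x z, inter_right_comm x z]
      · rw [← split (y ∩ z) x]
        congr 2 <;> · ext; simp; tauto
      · rw [split, split]
      · rw [split, inter_comm x, inter_comm xᶜ, split]
      · rw [inter_right_comm xᶜ y, inter_right_comm xᶜ yᶜ, split, inter_comm x, inter_comm xᶜ, split]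
      · rw [split, split, split, card_add_card_compl]
    rw [count, count]
    obtain ⟨h1, h2, h3, h4, h5, h6, h7⟩ := cards x y z
    obtain ⟨k1, k2, k3, k4, k5, k6, k7⟩ := cards x' y' z'
    obtain ⟨_ | _, _ | _, _ | _⟩ := b <;>
      simp only [if_true, if_false, Bool.false_eq_true] <;> omega
  have equiv (b : Bool × Bool × Bool) :
      Nonempty ({p // d x y z p = b} ≃ {p // d x' y' z' p = b}) :=
    Fintype.card_eq.1 <| by rw [Fintype.card_subtype, Fintype.card_subtype, key]
  let σ := Equiv.ofFiberEquiv fun b => (equiv b).some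
  have mem (p : α) : (σ p ∈ x' ↔ p ∈ x) ∧ (σ p ∈ y' ↔ p ∈ y) ∧ (σ p ∈ z' ↔ p ∈ z) := by
    have h : d x' y' z' (σ p) = d x y z p := Equiv.ofFiberEquiv_map _ p
    simpa only [d, Prod.mk.injEq, decide_eq_decide] using h
  refine ⟨σ, ?_, ?_, ?_⟩ <;> ext p <;> obtain ⟨q, rfl⟩ := σ.surjective p <;> simp [mem]

open Finset in
/-- Summing over all `2`-sets a function of the sizes of their intersections with `x`, `y`, `z`
is invariant under simultaneous permutation of `x`, `y`, `z`. -/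
lemma sum_pairs_map {α R : Type*} [Fintype α] [DecidableEq α] [AddCommMonoid R]
    (e : Equiv.Perm α) (x y z : Finset α) (H : ℕ → ℕ → ℕ → R) :
    ∑ w ∈ powersetCard 2 univ, H #(x ∩ w) #(y ∩ w) #(z ∩ w) =
      ∑ w ∈ powersetCard 2 univ, H #(x.map e.toEmbedding ∩ w) #(y.map e.toEmbedding ∩ w)
        #(z.map e.toEmbedding ∩ w) := by
  refine sum_equiv e.finsetCongr (by simp [mem_powersetCard]) fun w _ => ?_
  simp only [Equiv.finsetCongr_apply, ← map_inter, card_map]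

open Finset in
lemma pair_inter_eq_singleton {α : Type*} [DecidableEq α] {S : Finset α} {a b : α} (ha : a ∈ S)
    (hb : b ∉ S) : ({a, b} : Finset α) ∩ S = {a} := by
  rw [insert_inter_of_mem ha, singleton_inter_of_notMem hb, insert_empty_eq]

open Finset in
lemma exists_eq_pair_of_card_inter {α : Type*} [DecidableEq α] {S w : Finset α} (hw : #w = 2)
    (h : #(w ∩ S) = 1) : ∃ a ∈ S, ∃ b ∉ S, w = {a, b} := by
  obtain ⟨s, hs⟩ := card_eq_one.1 h
  have h1 : #(w \ S) = 1 := by have := card_inter_add_card_sdiff w S; omega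
  obtain ⟨p, hp⟩ := card_eq_one.1 h1
  have hs' : s ∈ w ∩ S := hs ▸ mem_singleton_self s
  have hp' : p ∈ w \ S := hp ▸ mem_singleton_self p
  refine ⟨s, by grind, p, by grind, (eq_of_subset_of_card_le (by grind) ?_).symm⟩
  rw [hw, card_pair (by grind)]

open Finset in
lemma sum_pairs_card_inter_eq_one {α R : Type*} [Fintype α] [DecidableEq α] [AddCommMonoid R]
    (S : Finset α) (G : Finset α → R) :
    ∑ w ∈ powersetCard 2 univ with #(w ∩ S) = 1, G w = ∑ a ∈ S, ∑ b ∈ Sᶜ, G {a, b} := by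
  rw [← sum_product']
  symm
  refine sum_nbij (fun p => {p.1, p.2}) ?_ ?_ ?_ fun _ _ => rfl
  · intro p hp
    simp only [mem_product, mem_compl] at hp
    simp only [mem_filter, mem_powersetCard, subset_univ, true_and,
      pair_inter_eq_singleton hp.1 hp.2, card_singleton, and_true]
    exact card_pair (by grind)
  · rintro ⟨a, b⟩ hp ⟨c, d⟩ hq h
    simp only [coe_product, Set.mem_prod, mem_coe, mem_compl] at hp hq h
    have h1 : ({a} : Finset α) = {c} := by
      rw [← pair_inter_eq_singleton hp.1 hp.2, h, pair_inter_eq_singleton hq.1 hq.2]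
    have : b ∈ ({c, d} : Finset α) := h ▸ by simp
    have hac : a = c := singleton_inj.1 h1
    have hbd : b = d := by grind
    rw [hac, hbd]
  · intro w hw
    simp only [coe_filter, mem_powersetCard, subset_univ, true_and, Set.mem_ofPred_eq] at hw
    obtain ⟨a, ha, b, hb, rfl⟩ := exists_eq_pair_of_card_inter hw.1 hw.2
    exact ⟨(a, b), by simp [ha, hb], rfl⟩

open Finset in
lemma sum_pairs_meeting_once {α R : Type*} [Fintype α] [DecidableEq α] [CommRing R]
    {S : Finset α} (hS : ((#Sᶜ : ℕ) : R) = 0) (G : Finset α → R) :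
    ∑ w ∈ powersetCard 2 univ with #(w ∩ S) = 1, G (w ∩ S) = 0 := by
  rw [sum_pairs_card_inter_eq_one S fun w => G (w ∩ S)]
  refine sum_eq_zero fun a ha => ?_
  rw [sum_congr rfl fun b hb => by rw [pair_inter_eq_singleton ha (mem_compl.1 hb)], sum_const,
    nsmul_eq_mul, hS, zero_mul]

open Finset in
/-- Replacing `z` by a disjoint `2`-set `z'` does not change the sum when `x` and `y` are contained
in `z ∪ z'` and meet `z` and `z'` equally: this interchanges stars and triangles. -/
lemma sum_pairs_exchange {α R : Type*} [Fintype α] [DecidableEq α] [CommRing R]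
    {x y z z' : Finset α} (hz : #z = 2) (hz' : #z' = 2) (hd : Disjoint z z')
    (hS : ((#(z ∪ z')ᶜ : ℕ) : R) = 0) (hx : x ⊆ z ∪ z') (hy : y ⊆ z ∪ z')
    (hxz : #(x ∩ z) = #(x ∩ z')) (hyz : #(y ∩ z) = #(y ∩ z')) (H : ℕ → ℕ → ℕ → R) :
    ∑ w ∈ powersetCard 2 univ, H #(x ∩ w) #(y ∩ w) #(z ∩ w) =
      ∑ w ∈ powersetCard 2 univ, H #(x ∩ w) #(y ∩ w) #(z' ∩ w) := by
  have once (u : Finset α) (hu : u ⊆ z ∪ z') :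
      ∑ w ∈ powersetCard 2 univ with #(w ∩ (z ∪ z')) = 1, H #(x ∩ w) #(y ∩ w) #(u ∩ w) = 0 := by
    rw [← sum_pairs_meeting_once hS fun w => H #(x ∩ w) #(y ∩ w) #(u ∩ w)]
    refine sum_congr rfl fun w _ => ?_
    have restrict {v : Finset α} (hv : v ⊆ z ∪ z') : v ∩ (w ∩ (z ∪ z')) = v ∩ w := by
      rw [inter_left_comm, inter_eq_left.2 hv, inter_comm]
    rw [restrict hx, restrict hy, restrict hu]
  rw [← sum_filter_add_sum_filter_not _ (fun w => #(w ∩ (z ∪ z')) = 1) fun w =>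
      H #(x ∩ w) #(y ∩ w) #(z ∩ w),
    ← sum_filter_add_sum_filter_not _ (fun w => #(w ∩ (z ∪ z')) = 1) fun w =>
      H #(x ∩ w) #(y ∩ w) #(z' ∩ w),
    once z subset_union_left, once z' subset_union_right]
  congr 1
  have hzS : z ∩ (z ∪ z') = z := inter_eq_left.2 subset_union_left
  have hzS' : z' ∩ (z ∪ z') = z' := inter_eq_left.2 subset_union_right
  have hzz' : z ∩ z' = ∅ := disjoint_iff_inter_eq_empty.1 hd
  have hzz'' : z' ∩ z = ∅ := by rw [inter_comm, hzz']
  refine sum_equiv (Equiv.swap z z') (fun w => ?_) fun w hw => ?_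
  · by_cases h1 : w = z
    · subst h1; simp [mem_powersetCard, hz, hz', hzS, hzS']
    by_cases h2 : w = z'
    · subst h2; simp [mem_powersetCard, hz, hz', hzS, hzS']
    rw [Equiv.swap_apply_of_ne_of_ne h1 h2]
  · by_cases h1 : w = z
    · subst h1; simp [hxz, hyz, hz, hz']
    by_cases h2 : w = z'
    · subst h2; simp [hxz, hyz, hzz', hzz'']
    rw [Equiv.swap_apply_of_ne_of_ne h1 h2]
    simp only [mem_filter, mem_powersetCard, subset_univ, true_and] at hw
    have h3 : #(z ∩ w) + #(z' ∩ w) = #(w ∩ (z ∪ z')) := by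
      rw [inter_comm w, union_inter_distrib_right, card_union_of_disjoint]
      exact hd.mono inter_subset_left inter_subset_left
    have ne_two {u : Finset α} (hu : #u = 2) (hwu : w ≠ u) : #(u ∩ w) ≠ 2 := fun h => by
      have e1 : u ∩ w = u := eq_of_subset_of_card_le inter_subset_left (by omega)
      have e2 : u ∩ w = w := eq_of_subset_of_card_le inter_subset_right (by omega)
      exact hwu (e2.symm.trans e1)
    have h4 := ne_two hz h1
    have h5 := ne_two hz' h2
    have h6 : #(w ∩ (z ∪ z')) ≤ #w := card_le_card inter_subset_left
    rw [show #(z ∩ w) = #(z' ∩ w) by omega]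

open Finset in
/-- If `|α| = 4` in `R`, the triple intersection numbers of the Johnson scheme on the `2`-sets
of `α` depend, in `R`, only on the pairwise relations of the three points. -/
lemma sum_pairs_eq_of_card_inter {α R : Type*} [Fintype α] [DecidableEq α] [CommRing R]
    (hR : ((Fintype.card α : ℕ) : R) = 4) {x y z y' z' : Finset α} (hx : #x = 2)
    (hy : #y = 2) (hz : #z = 2) (hy' : #y' = 2) (hz' : #z' = 2)
    (hxy : #(x ∩ y) = #(x ∩ y')) (hxz : #(x ∩ z) = #(x ∩ z')) (hyz : #(y ∩ z) = #(y' ∩ z'))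
    (H : ℕ → ℕ → ℕ → R) :
    ∑ w ∈ powersetCard 2 univ, H #(x ∩ w) #(y ∩ w) #(z ∩ w) =
      ∑ w ∈ powersetCard 2 univ, H #(x ∩ w) #(y' ∩ w) #(z' ∩ w) := by
  have same {y z y' z' : Finset α} (hy : #y = 2) (hz : #z = 2) (hy' : #y' = 2) (hz' : #z' = 2)
      (hxy : #(x ∩ y) = #(x ∩ y')) (hxz : #(x ∩ z) = #(x ∩ z')) (hyz : #(y ∩ z) = #(y' ∩ z'))
      (ht : #(x ∩ y ∩ z) = #(x ∩ y' ∩ z')) :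
      ∑ w ∈ powersetCard 2 univ, H #(x ∩ w) #(y ∩ w) #(z ∩ w) =
        ∑ w ∈ powersetCard 2 univ, H #(x ∩ w) #(y' ∩ w) #(z' ∩ w) := by
    obtain ⟨e, h1, h2, h3⟩ := exists_perm_map_eq_s13 (x := x) (x' := x) (y := y) (y' := y')
      (z := z) (z' := z') rfl (by omega) (by omega) hxy hxz hyz ht
    rw [sum_pairs_map e, h1, h2, h3]
  have star {y z y' z' : Finset α} (hy : #y = 2) (hz : #z = 2) (hy' : #y' = 2) (hz' : #z' = 2)
      (hxy : #(x ∩ y) = 1) (hxz : #(x ∩ z) = 1) (hyz : #(y ∩ z) = 1)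
      (hxy' : #(x ∩ y') = 1) (hxz' : #(x ∩ z') = 1) (hyz' : #(y' ∩ z') = 1)
      (ht : #(x ∩ y ∩ z) = 1) (ht' : #(x ∩ y' ∩ z') = 0) :
      ∑ w ∈ powersetCard 2 univ, H #(x ∩ w) #(y ∩ w) #(z ∩ w) =
        ∑ w ∈ powersetCard 2 univ, H #(x ∩ w) #(y' ∩ w) #(z' ∩ w) := by
    have hu := card_union_add_card_inter x y
    have hu' := card_union_add_card_inter (x ∪ y) z
    have hu'' := card_union_add_card_inter (x ∩ z) (y ∩ z)
    rw [← union_inter_distrib_right, ← inter_inter_distrib_right] at hu''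
    have sub : z ⊆ x ∪ y ∪ z := subset_union_right
    have hS : z ∪ (x ∪ y ∪ z) \ z = x ∪ y ∪ z := union_sdiff_of_subset sub
    have meet {v : Finset α} (hv : v ⊆ x ∪ y ∪ z) : v ∩ ((x ∪ y ∪ z) \ z) = v \ z := by
      rw [← inter_sdiff_assoc, inter_eq_left.2 hv]
    have hxs : x ⊆ x ∪ y ∪ z := subset_union_left.trans subset_union_left
    have hys : y ⊆ x ∪ y ∪ z := subset_union_right.trans subset_union_left
    have cx := card_inter_add_card_sdiff x z
    have cy := card_inter_add_card_sdiff y z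
    have cxy := card_inter_add_card_sdiff (x ∩ y) z
    have c := card_sdiff_add_card_eq_card sub
    have c2 : #((x ∪ y ∪ z) \ z) = 2 := by omega
    refine (sum_pairs_exchange (z' := (x ∪ y ∪ z) \ z) hz c2 disjoint_sdiff ?_ ?_ ?_ ?_ ?_
      H).trans ?_
    · rw [hS, card_compl, Nat.cast_sub (card_le_univ _), hR,
        show #(x ∪ y ∪ z) = 4 by omega]
      norm_num
    · rwa [hS]
    · rwa [hS]
    · rw [meet hxs]; omega
    · rw [meet hys]; omega
    · refine same hy c2 hy' hz' (by omega) ?_ ?_ ?_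
      · rw [meet hxs]; omega
      · rw [meet hys]; omega
      · rw [meet (inter_subset_left.trans hxs)]; omega
  have bounds {y z : Finset α} (hy : #y = 2) (hz : #z = 2) :
      #(x ∩ y ∩ z) ≤ #(x ∩ y) ∧ #(x ∩ y ∩ z) ≤ #(x ∩ z) ∧ #(x ∩ y ∩ z) ≤ #(y ∩ z) ∧
      #(x ∩ y) + #(x ∩ z) ≤ 2 + #(x ∩ y ∩ z) ∧ #(x ∩ y) + #(y ∩ z) ≤ 2 + #(x ∩ y ∩ z) ∧
      #(x ∩ z) + #(y ∩ z) ≤ 2 + #(x ∩ y ∩ z) ∧ #(x ∩ y) ≤ 2 ∧ #(x ∩ z) ≤ 2 ∧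
      #(y ∩ z) ≤ 2 := by
    have le {A B C t : Finset α} (hC : #C = 2) (hA : A ⊆ C) (hB : B ⊆ C) (ht : A ∩ B = t) :
        #A + #B ≤ 2 + #t := by
      rw [← card_union_add_card_inter, ht, ← hC]
      gcongr
      exact union_subset hA hB
    have t1 : x ∩ y ∩ z ⊆ x ∩ z := inter_subset_inter_right inter_subset_left
    have t2 : x ∩ y ∩ z ⊆ y ∩ z := inter_subset_inter_right inter_subset_right
    refine ⟨card_le_card inter_subset_left, card_le_card t1, card_le_card t2,
      le hx inter_subset_left inter_subset_left ?_, le hy inter_subset_right inter_subset_left ?_,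
      le hz inter_subset_right inter_subset_right (inter_inter_distrib_right x y z).symm,
      hx ▸ card_le_card inter_subset_left, hx ▸ card_le_card inter_subset_left,
      hy ▸ card_le_card inter_subset_left⟩
    · rw [← inter_inter_distrib_left, inter_assoc]
    · rw [← inter_assoc, inter_assoc x, inter_self]
  by_cases ht : #(x ∩ y ∩ z) = #(x ∩ y' ∩ z')
  · exact same hy hz hy' hz' hxy hxz hyz ht
  have b := bounds hy hz
  have b' := bounds hy' hz'
  obtain h | h := Nat.lt_or_gt_of_ne ht
  · exact (star hy' hz' hy hz (by omega) (by omega) (by omega) (by omega) (by omega) (by omega)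
      (by omega) (by omega)).symm
  · exact star hy hz hy' hz' (by omega) (by omega) (by omega) (by omega) (by omega) (by omega)
      (by omega) (by omega)

open Finset in
/-- The matrices whose `(y,z)`-entry depends, modulo `d`, only on the pairwise relations
of `x`, `y`, `z`. -/
def IsTriplyRegularMod (n d : ℕ) (hn : 2 ≤ n) (m : Matrix (JPoint n) (JPoint n) ℤ) : Prop :=
  ∃ F : ℕ → ℕ → ℕ → ZMod d, ∀ y z,
    (m y z : ZMod d) = F #((Jx n hn).1 ∩ y.1) #((Jx n hn).1 ∩ z.1) #(y.1 ∩ z.1)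

open Finset in
lemma JPoint.eq_iff_card_inter {n : ℕ} (y z : JPoint n) : y = z ↔ #(y.1 ∩ z.1) = 2 := by
  refine ⟨fun h => by rw [h, inter_self, z.2], fun h => Subtype.ext ?_⟩
  have e1 : y.1 ∩ z.1 = y.1 := eq_of_subset_of_card_le inter_subset_left (by rw [h, y.2])
  have e2 : y.1 ∩ z.1 = z.1 := eq_of_subset_of_card_le inter_subset_right (by rw [h, z.2])
  exact e1.symm.trans e2

lemma JE_mul_Jσ_mul_JE_apply {R : Type*} [CommRing R] {n : ℕ} (hn : 2 ≤ n) (i j k : Fin 3)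
    (y z : JPoint n) :
    (JE R n hn i * Jσ R n j * JE R n hn k) y z = JE R n hn i y y * Jσ R n j y z *
      JE R n hn k z z := by
  simp [JE]

open Finset in
lemma isTriplyRegularMod_of_mem_JT {n : ℕ} (hn' : 2 ≤ n) (hn : 4 ≤ n)
    {m : Matrix (JPoint n) (JPoint n) ℤ} (hm : m ∈ JT ℤ n hn') :
    IsTriplyRegularMod n (n - 4) hn' m := by
  have hcard : ((Fintype.card (Fin n) : ℕ) : ZMod (n - 4)) = 4 := by
    rw [Fintype.card_fin, ← sub_eq_zero, ← ZMod.natCast_self (n - 4), Nat.cast_sub hn]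
    simp
  induction hm using Algebra.adjoin_induction with
  | mem m hm =>
    obtain ⟨i, j, k, rfl⟩ := hm
    let e (i : Fin 3) (a : ℕ) : ℤ :=
      if i = 0 then (if a = 2 then 1 else 0) else if i = 1 then (if a = 1 then 1 else 0)
      else if a = 0 then 1 else 0
    refine ⟨fun a b c => (e i a * e j c * e k b : ℤ), fun y z => ?_⟩
    rw [JE_mul_Jσ_mul_JE_apply]
    simp only [JE, Jσ, Matrix.diagonal_apply_eq, Matrix.of_apply, e, JPoint.eq_iff_card_inter,
      ← card_eq_zero]
  | algebraMap r =>
    refine ⟨fun _ _ c => if c = 2 then (r : ZMod (n - 4)) else 0, fun y z => ?_⟩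
    simp [Matrix.algebraMap_matrix_apply, JPoint.eq_iff_card_inter]
  | add a b _ _ ha hb =>
    obtain ⟨F, hF⟩ := ha
    obtain ⟨G, hG⟩ := hb
    exact ⟨F + G, fun y z => by simp [hF, hG]⟩
  | mul a b _ _ ha hb =>
    obtain ⟨F, hF⟩ := ha
    obtain ⟨G, hG⟩ := hb
    obtain ⟨x, hx, hx2⟩ : ∃ x, (Jx n hn').1 = x ∧ #x = 2 := ⟨_, rfl, (Jx n hn').2⟩
    rw [hx] at hF hG
    have entry (y z : JPoint n) : ((a * b) y z : ZMod (n - 4)) =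
        ∑ w ∈ powersetCard 2 univ, (fun i j k => F #(x ∩ y.1) i j * G i #(x ∩ z.1) k)
          #(x ∩ w) #(y.1 ∩ w) #(z.1 ∩ w) := by
      rw [sum_subtype (p := fun w => #w = 2) _ (by simp [mem_powersetCard])]
      simp only [Matrix.mul_apply, Int.cast_sum, Int.cast_mul, hF, hG]
      exact sum_congr rfl fun w _ => by rw [inter_comm w.1]
    have indep (y z y' z' : JPoint n) (hy : #(x ∩ y.1) = #(x ∩ y'.1))
        (hz : #(x ∩ z.1) = #(x ∩ z'.1)) (hyz : #(y.1 ∩ z.1) = #(y'.1 ∩ z'.1)) :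
        ((a * b) y z : ZMod (n - 4)) = ((a * b) y' z' : ZMod (n - 4)) := by
      rw [entry, entry, hy, hz]
      exact sum_pairs_eq_of_card_inter hcard hx2 y.2 z.2 y'.2 z'.2 hy hz hyz
        fun i j k => F #(x ∩ y'.1) i j * G i #(x ∩ z'.1) k
    classical
    refine ⟨fun i j k => if h : ∃ p : JPoint n × JPoint n, #(x ∩ p.1.1) = i ∧
      #(x ∩ p.2.1) = j ∧ #(p.1.1 ∩ p.2.1) = k then ((a * b) h.choose.1 h.choose.2 : ZMod (n - 4))
      else 0, fun y z => ?_⟩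
    have h : ∃ p : JPoint n × JPoint n, #(x ∩ p.1.1) = #(x ∩ y.1) ∧
      #(x ∩ p.2.1) = #(x ∩ z.1) ∧ #(p.1.1 ∩ p.2.1) = #(y.1 ∩ z.1) := ⟨(y, z), rfl, rfl, rfl⟩
    rw [hx]
    beta_reduce
    rw [dif_pos h]
    exact indep _ _ _ _ h.choose_spec.1.symm h.choose_spec.2.1.symm h.choose_spec.2.2.symm

open Finset in
lemma JM_notMem_JT {n : ℕ} (hn' : 2 ≤ n) (hn : 6 ≤ n) : JM ℤ n hn' ∉ JT ℤ n hn' := by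
  intro h
  obtain ⟨F, hF⟩ := isTriplyRegularMod_of_mem_JT hn' (by omega) h
  let p0 : Fin n := ⟨0, by omega⟩
  let p1 : Fin n := ⟨1, by omega⟩
  let p2 : Fin n := ⟨2, by omega⟩
  let p3 : Fin n := ⟨3, by omega⟩
  have h01 : p0 ≠ p1 := by simp [p0, p1]
  have h02 : p0 ≠ p2 := by simp [p0, p2]
  have h03 : p0 ≠ p3 := by simp [p0, p3]
  have h12 : p1 ≠ p2 := by simp [p1, p2]
  have h13 : p1 ≠ p3 := by simp [p1, p3]
  have h23 : p2 ≠ p3 := by simp [p2, p3]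
  have hx : (Jx n hn').1 = {p0, p1} := rfl
  have meet {A B : Finset (Fin n)} (p : Fin n) (h : A ∩ B = {p}) : #(A ∩ B) = 1 := by
    rw [h, card_singleton]
  have e1 := hF ⟨{p0, p2}, card_pair h02⟩ ⟨{p1, p2}, card_pair h12⟩
  have e2 := hF ⟨{p0, p2}, card_pair h02⟩ ⟨{p0, p3}, card_pair h03⟩
  simp only [hx] at e1 e2
  rw [meet p0 (by grind), meet p1 (by grind), meet p2 (by grind)] at e1
  rw [meet p0 (A := {p0, p1}) (B := {p0, p2}) (by grind),
    meet p0 (A := {p0, p1}) (B := {p0, p3}) (by grind),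
    meet p0 (A := {p0, p2}) (B := {p0, p3}) (by grind)] at e2
  rw [← e2, JM, Matrix.of_apply, Matrix.of_apply, if_pos ⟨p2, le_rfl, Or.inl ⟨rfl, rfl⟩⟩,
    if_neg] at e1
  · have : Fact (1 < n - 4) := ⟨by omega⟩
    simp at e1
  · rintro ⟨c, hc, ⟨h1, h2⟩ | ⟨h1, h2⟩⟩
    · have : p0 ∈ ({⟨1, by omega⟩, c} : Finset (Fin n)) := h2 ▸ by simp
      simp [p0, Fin.ext_iff] at this
      omega
    · have : p0 ∈ ({⟨1, by omega⟩, c} : Finset (Fin n)) := h1 ▸ by simp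
      simp [p0, Fin.ext_iff] at this
      omega

open Finset in
lemma card_pair_inter_pair {α : Type*} [DecidableEq α] {S : Finset α} {a b c d : α} (ha : a ∈ S)
    (hb : b ∈ S) (hc : c ∉ S) (hd : d ∉ S) :
    #(({a, c} : Finset α) ∩ {b, d}) = (if a = b then 1 else 0) + if c = d then 1 else 0 := by
  split_ifs with h1 h2 h2
  · rw [h1, h2, inter_self, card_pair (by grind)]
  · rw [show ({a, c} : Finset α) ∩ {b, d} = {a} by grind, card_singleton]
  · rw [show ({a, c} : Finset α) ∩ {b, d} = {c} by grind, card_singleton]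
  · rw [show ({a, c} : Finset α) ∩ {b, d} = ∅ by grind, card_empty]

open Finset in
lemma JM_apply_pair (R : Type*) [CommRing R] {n : ℕ} (hn : 2 ≤ n) {y z : JPoint n}
    {a b c e : Fin n} (ha : a ∈ (Jx n hn).1) (hb : b ∈ (Jx n hn).1) (hc : c ∉ (Jx n hn).1)
    (he : e ∉ (Jx n hn).1) (hy : y.1 = {a, c}) (hz : z.1 = {b, e}) :
    JM R n hn y z = if a ≠ b ∧ c = e then 1 else 0 := by
  have big (c : Fin n) : c ∉ (Jx n hn).1 ↔ 2 ≤ c.val := by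
    simp [Jx, Fin.ext_iff]; omega
  have hx : (Jx n hn).1 = {⟨0, by omega⟩, ⟨1, by omega⟩} := rfl
  simp only [JM, Matrix.of_apply, ← big, hy, hz]
  have h01 : (⟨0, by omega⟩ : Fin n) ≠ ⟨1, by omega⟩ := by simp
  refine if_congr ?_ rfl rfl
  rw [hx] at ha hb hc he ⊢
  clear big hx hy hz
  generalize (⟨0, by omega⟩ : Fin n) = p at *
  generalize (⟨1, by omega⟩ : Fin n) = q at *
  constructor
  · rintro ⟨c', hc', ⟨h1, h2⟩ | ⟨h1, h2⟩⟩
    · have : a ∈ ({p, c'} : Finset (Fin n)) := h1 ▸ by simp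
      have : c ∈ ({p, c'} : Finset (Fin n)) := h1 ▸ by simp
      have : b ∈ ({q, c'} : Finset (Fin n)) := h2 ▸ by simp
      have : e ∈ ({q, c'} : Finset (Fin n)) := h2 ▸ by simp
      grind
    · have : a ∈ ({q, c'} : Finset (Fin n)) := h1 ▸ by simp
      have : c ∈ ({q, c'} : Finset (Fin n)) := h1 ▸ by simp
      have : b ∈ ({p, c'} : Finset (Fin n)) := h2 ▸ by simp
      have : e ∈ ({p, c'} : Finset (Fin n)) := h2 ▸ by simp
      grind
  · rintro ⟨hab, rfl⟩
    refine ⟨c, hc, ?_⟩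
    grind

open Finset in
lemma JM_apply_eq_zero (R : Type*) [CommRing R] {n : ℕ} (hn : 2 ≤ n) {y z : JPoint n}
    (h : ¬ (#((Jx n hn).1 ∩ y.1) = 1 ∧ #((Jx n hn).1 ∩ z.1) = 1)) : JM R n hn y z = 0 := by
  rw [JM, Matrix.of_apply, if_neg]
  rintro ⟨c, hc, hyz⟩
  have hc' : c ∉ (Jx n hn).1 := by simp [Jx, Fin.ext_iff]; omega
  have one {w : JPoint n} {a : Fin n} (ha : a ∈ (Jx n hn).1) (hw : w.1 = {a, c}) :
      #((Jx n hn).1 ∩ w.1) = 1 := by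
    rw [hw, inter_comm, pair_inter_eq_singleton ha hc', card_singleton]
  have h0 : (⟨0, by omega⟩ : Fin n) ∈ (Jx n hn).1 := by simp [Jx]
  have h1 : (⟨1, by omega⟩ : Fin n) ∈ (Jx n hn).1 := by simp [Jx]
  obtain ⟨hy, hz⟩ | ⟨hy, hz⟩ := hyz
  · exact h ⟨one h0 hy, one h1 hz⟩
  · exact h ⟨one h1 hy, one h0 hz⟩

open Finset in
lemma JE_one_mul_Jσ_mul_JE_one_apply (R : Type*) [CommRing R] {n : ℕ} (hn : 2 ≤ n) (j : Fin 3)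
    (y z : JPoint n) :
    (JE R n hn 1 * Jσ R n j * JE R n hn 1) y z =
      if #((Jx n hn).1 ∩ y.1) = 1 ∧ #((Jx n hn).1 ∩ z.1) = 1 then Jσ R n j y z else 0 := by
  rw [JE_mul_Jσ_mul_JE_apply]
  simp only [JE, Matrix.diagonal_apply_eq, one_ne_zero, if_false, if_true]
  split_ifs <;> simp_all

open Finset in
/-- In `RT(x)` one has `A₁ A₂ = A₁ + (n - 4) (A₂ + M)`, where `Aⱼ = E₁* σⱼ E₁*`. -/
lemma JE_Jσ_one_mul_two (R : Type*) [CommRing R] {n : ℕ} (hn : 2 ≤ n) :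
    (JE R n hn 1 * Jσ R n 1 * JE R n hn 1) * (JE R n hn 1 * Jσ R n 2 * JE R n hn 1) =
      JE R n hn 1 * Jσ R n 1 * JE R n hn 1 +
        ((n : R) - 4) • (JE R n hn 1 * Jσ R n 2 * JE R n hn 1 + JM R n hn) := by
  ext y z
  rw [Matrix.mul_apply, Matrix.add_apply, Matrix.smul_apply, Matrix.add_apply]
  simp only [JE_one_mul_Jσ_mul_JE_one_apply]
  by_cases h : #((Jx n hn).1 ∩ y.1) = 1 ∧ #((Jx n hn).1 ∩ z.1) = 1
  swap
  · rw [JM_apply_eq_zero R hn h, if_neg h, if_neg h, sum_eq_zero]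
    · simp
    · intro w _
      split_ifs <;> simp_all
  rw [if_pos h, if_pos h]
  obtain ⟨hy, hz⟩ := h
  simp only [hy, hz, and_true, true_and]
  obtain ⟨a, ha, c, hc, hyp⟩ := exists_eq_pair_of_card_inter y.2 (inter_comm _ y.1 ▸ hy)
  obtain ⟨b, hb, e, he, hzp⟩ := exists_eq_pair_of_card_inter z.2 (inter_comm _ z.1 ▸ hz)
  rw [JM_apply_pair R hn ha hb hc he hyp hzp]
  have hx2 := (Jx n hn).2
  generalize (Jx n hn).1 = x at *
  have expand : ∑ w : JPoint n, ((if #(x ∩ w.1) = 1 then Jσ R n 1 y w else 0) *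
      if #(x ∩ w.1) = 1 then Jσ R n 2 w z else 0) =
      ∑ s ∈ x, ∑ d ∈ xᶜ, if ((a = s ∧ c ≠ d) ∨ (a ≠ s ∧ c = d)) ∧ b ≠ s ∧ e ≠ d then (1 : R)
        else 0 := by
    trans ∑ w ∈ powersetCard 2 univ with #(w ∩ x) = 1,
      if #(y.1 ∩ w) = 1 ∧ #(z.1 ∩ w) = 0 then (1 : R) else 0
    · rw [sum_filter, sum_subtype (p := fun w => #w = 2) _ (by simp [mem_powersetCard])]
      refine sum_congr rfl fun w _ => ?_
      rw [inter_comm x, inter_comm z.1]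
      simp only [Jσ, Matrix.of_apply, ← card_eq_zero]
      split_ifs <;> simp_all
    · rw [sum_pairs_card_inter_eq_one]
      refine sum_congr rfl fun s hs => sum_congr rfl fun d hd => if_congr ?_ rfl rfl
      rw [mem_compl] at hd
      rw [hyp, hzp, card_pair_inter_pair ha hs hc hd, card_pair_inter_pair hb hs he hd]
      split_ifs <;> simp_all
  rw [expand]
  have hσ1 : Jσ R n 1 y z = if (a = b ∧ c ≠ e) ∨ (a ≠ b ∧ c = e) then 1 else 0 := by
    simp only [Jσ, Matrix.of_apply, one_ne_zero, if_false, if_true]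
    refine if_congr ?_ rfl rfl
    rw [hyp, hzp, card_pair_inter_pair ha hb hc he]
    split_ifs <;> simp_all
  have hσ2 : Jσ R n 2 y z = if a ≠ b ∧ c ≠ e then 1 else 0 := by
    simp only [Jσ, Matrix.of_apply, ← card_eq_zero]
    rw [if_neg (by decide), if_neg (by decide)]
    refine if_congr ?_ rfl rfl
    rw [hyp, hzp, card_pair_inter_pair ha hb hc he]
    split_ifs <;> simp_all
  rw [hσ1, hσ2]
  obtain ⟨a', ha'⟩ := card_eq_one.1 (by rw [card_erase_of_mem ha, hx2] : #(x.erase a) = 1)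
  have haa' : a ≠ a' := by
    have : a' ∈ x.erase a := ha' ▸ mem_singleton_self a'
    grind
  rw [← add_sum_erase x _ ha, ha', sum_singleton]
  have hba : b = a ∨ b = a' := by
    by_contra! hne
    have : b ∈ x.erase a := mem_erase.2 ⟨hne.1, hb⟩
    grind
  have hc' := mem_compl.2 hc
  obtain rfl | rfl := hba
  · simp only [ne_eq, not_true_eq_false, false_and, and_false, if_false, sum_const_zero, zero_add,
      haa', not_false_eq_true, true_and, or_false, false_or, add_zero, smul_zero]
    by_cases hce : c = e
    · subst hce
      simp
    · simp [hce, ite_and, hc', Ne.symm hce]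
  · simp only [ne_eq, not_true_eq_false, false_and, and_false, if_false, sum_const_zero, add_zero,
      haa', Ne.symm haa', not_false_eq_true, true_and, or_false, false_or]
    rw [sum_boole]
    have hfilter : {d ∈ xᶜ | ¬ c = d ∧ ¬ e = d} = (xᶜ.erase c).erase e := by grind
    have hcard := card_compl x
    have hle := card_le_univ x
    rw [hx2, Fintype.card_fin] at hcard hle
    have hcc := card_erase_add_one hc'
    by_cases hce : c = e
    · subst hce
      rw [hfilter, erase_idem]
      have hn' : (n : R) = #(xᶜ.erase c) + 3 := by
        rw [← Nat.cast_ofNat, ← Nat.cast_add]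
        exact congrArg _ (by omega)
      simp only [hn', not_true_eq_false, if_true, if_false, smul_eq_mul]
      ring
    · have hee := card_erase_add_one (mem_erase.2 ⟨Ne.symm hce, mem_compl.2 he⟩)
      have hn' : (n : R) = #((xᶜ.erase c).erase e) + 4 := by
        rw [← Nat.cast_ofNat, ← Nat.cast_add]
        exact congrArg _ (by omega)
      simp only [hfilter, hn', hce, not_false_eq_true, if_true, if_false, smul_eq_mul]
      ring

lemma JM_mem_JT {n : ℕ} (hn' : 2 ≤ n) (hn : 6 ≤ n) : JM ℚ n hn' ∈ JT ℚ n hn' := by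
  have gen (j : Fin 3) : JE ℚ n hn' 1 * Jσ ℚ n j * JE ℚ n hn' 1 ∈ JT ℚ n hn' :=
    Algebra.subset_adjoin ⟨1, j, 1, rfl⟩
  have hne : (n : ℚ) - 4 ≠ 0 := by
    have : (6 : ℚ) ≤ n := by exact_mod_cast hn
    linarith
  have h := JE_Jσ_one_mul_two ℚ hn'
  have hM : JM ℚ n hn' = ((n : ℚ) - 4)⁻¹ •
      ((JE ℚ n hn' 1 * Jσ ℚ n 1 * JE ℚ n hn' 1) * (JE ℚ n hn' 1 * Jσ ℚ n 2 * JE ℚ n hn' 1) -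
        JE ℚ n hn' 1 * Jσ ℚ n 1 * JE ℚ n hn' 1) - JE ℚ n hn' 1 * Jσ ℚ n 2 * JE ℚ n hn' 1 := by
    rw [h, add_sub_cancel_left, inv_smul_smul₀ hne, add_sub_cancel_left]
  rw [hM]
  exact sub_mem (Subalgebra.smul_mem _ (sub_mem (mul_mem (gen 1) (gen 2)) (gen 1)) _) (gen 2)

lemma map_mem_JT {n : ℕ} (hn : 2 ≤ n) {m : Matrix (JPoint n) (JPoint n) ℤ} (hm : m ∈ JT ℤ n hn) :
    m.map (Int.cast : ℤ → ℚ) ∈ JT ℚ n hn := by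
  change (Int.castRingHom ℚ).mapMatrix m ∈ _
  induction hm using Algebra.adjoin_induction with
  | mem m hm =>
    obtain ⟨i, j, k, rfl⟩ := hm
    refine Algebra.subset_adjoin ⟨i, j, k, ?_⟩
    ext y z
    simp [JE, Jσ, apply_ite (Int.cast : ℤ → ℚ)]
  | algebraMap r =>
    rw [eq_intCast (algebraMap ℤ (Matrix (JPoint n) (JPoint n) ℤ)) r, map_intCast]
    exact intCast_mem _ r
  | add a b _ _ ha hb => rw [map_add]; exact add_mem ha hb
  | mul a b _ _ ha hb => rw [map_mul]; exact mul_mem ha hb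

/-- **Theorem.** For `J(n,2)` (`n ≥ 6`) with base point `x = {1,2}`, the matrix `M` lies in
`ℚT(x) ∩ M_X(ℤ)` but not in `ℤT(x)`; in particular `ℤT(x) ⊊ ℚT(x) ∩ M_X(ℤ)`.  This answers
negatively Terwilliger's question whether `ℤT(x) = ℚT(x) ∩ M_X(ℤ)` always holds. -/
theorem johnson_ZT_proper (n : ℕ) (hn : 6 ≤ n) :
    ((JM ℤ n (by omega)).map (Int.cast : ℤ → ℚ) ∈ JT ℚ n (by omega) ∧
      JM ℤ n (by omega) ∉ JT ℤ n (by omega)) ∧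
    (JT ℤ n (by omega) : Set (Matrix (JPoint n) (JPoint n) ℤ)) ⊂
      {m : Matrix (JPoint n) (JPoint n) ℤ | m.map (Int.cast : ℤ → ℚ) ∈ JT ℚ n (by omega)} := by
  have hM : (JM ℤ n (by omega)).map (Int.cast : ℤ → ℚ) ∈ JT ℚ n (by omega) := by
    convert JM_mem_JT (by omega) hn using 1
    ext y z
    simp [JM, apply_ite (Int.cast : ℤ → ℚ)]
  exact ⟨⟨hM, JM_notMem_JT _ hn⟩, fun m hm => map_mem_JT _ hm,
    fun h => JM_notMem_JT _ hn (h hM)⟩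
end

section
/- Let n ≥ 5 and let (X,S) be the Johnson scheme J(n,2) with fixed point x = {1,2}. Then in M_X(ℤ) the following identity holds: (E₁*σ₁E₁*)·(E₁*σ₁E₁*) = (n−2)·E₁*σ₀E₁* + (n−4)·E₁*σ₁E₁* + 2·E₁*σ₂E₁* − (n−4)·M. -/
open Matrix

theorem card_inter_pair_eq_one_iff {α : Type*} [DecidableEq α] {p q r s : α}
    (hpq : p ≠ q) :
    (({p, q} : Finset α) ∩ {r, s}).card = 1 ↔ ¬((p = r ∨ p = s) ↔ (q = r ∨ q = s)) := by
  by_cases h₁ : p = r ∨ p = s <;> by_cases h₂ : q = r ∨ q = s <;>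
    simp [Finset.insert_inter_of_mem,
      Finset.insert_inter_of_notMem, Finset.singleton_inter_of_mem,
      Finset.singleton_inter_of_notMem, h₁, h₂, hpq]

theorem inter_pair_eq_empty_iff {α : Type*} [DecidableEq α] {p q r s : α} :
    (({p, q} : Finset α) ∩ {r, s}) = ∅ ↔ (p ≠ r ∧ p ≠ s) ∧ q ≠ r ∧ q ≠ s := by
  simp [eq_comm]
  grind

/-- The indices other than those of the base point `{1,2}`. -/
abbrev JIndex (n : ℕ) : Type := {k : Fin n // 2 ≤ k.val}

/-- The two elements of the base point `{1,2}`. -/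
def Jbase (n : ℕ) (hn : 2 ≤ n) (a : Bool) : Fin n :=
  if a then ⟨1, by omega⟩ else ⟨0, by omega⟩

theorem Jbase_inj {n : ℕ} {hn : 2 ≤ n} {a b : Bool} :
    Jbase n hn a = Jbase n hn b ↔ a = b := by
  cases a <;> cases b <;> simp [Jbase]

theorem Jbase_ne {n : ℕ} {hn : 2 ≤ n} (a : Bool) (k : JIndex n) : Jbase n hn a ≠ k.1 := by
  have := k.2
  cases a <;> simp only [Jbase, ne_eq, Fin.ext_iff] <;> grind

/-- The points meeting `{1,2}` in exactly one element, as a `2 × (n - 2)` grid. -/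
def Jgrid (n : ℕ) (hn : 2 ≤ n) (v : Bool × JIndex n) : JPoint n :=
  ⟨{Jbase n hn v.1, v.2.1}, Finset.card_pair (Jbase_ne _ _)⟩

theorem Jgrid_injective (n : ℕ) (hn : 2 ≤ n) : Function.Injective (Jgrid n hn) := by
  rintro ⟨a, i⟩ ⟨b, j⟩ h
  have h' : ({Jbase n hn a, i.1} : Finset (Fin n)) = {Jbase n hn b, j.1} := congrArg Subtype.val h
  have h₁ : Jbase n hn a ∈ ({Jbase n hn b, j.1} : Finset (Fin n)) := h' ▸ by simp
  have h₂ : i.1 ∈ ({Jbase n hn b, j.1} : Finset (Fin n)) := h' ▸ by simp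
  simp only [Finset.mem_insert, Finset.mem_singleton, Jbase_ne, (Jbase_ne _ _).symm, or_false,
    false_or, Jbase_inj] at h₁ h₂
  rw [h₁, Subtype.ext h₂]

theorem card_Jx_inter_eq_one_iff {n : ℕ} {hn : 2 ≤ n} {w : JPoint n} :
    ((Jx n hn).1 ∩ w.1).card = 1 ↔ w ∈ Set.range (Jgrid n hn) := by
  have hx : (Jx n hn).1 = {Jbase n hn false, Jbase n hn true} := by simp [Jx, Jbase]
  have hne : Jbase n hn false ≠ Jbase n hn true := by simp [Jbase_inj]
  constructor
  · intro h
    obtain ⟨w, hw⟩ := w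
    obtain ⟨r, s, hrs, rfl⟩ := Finset.card_eq_two.1 hw
    have hlarge : ∀ k : Fin n, Jbase n hn false ≠ k → Jbase n hn true ≠ k → 2 ≤ k.val := by
      intro k h₀ h₁
      simp only [Jbase, ne_eq, Fin.ext_iff] at h₀ h₁
      grind
    rw [hx, card_inter_pair_eq_one_iff hne] at h
    replace h : Xor (Jbase n hn false = r ∨ Jbase n hn false = s)
        (Jbase n hn true = r ∨ Jbase n hn true = s) := by
      rwa [xor_iff_not_iff]
    have key : ∃ a : Bool, (Jbase n hn a = r ∧ 2 ≤ s.val) ∨ (Jbase n hn a = s ∧ 2 ≤ r.val) := by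
      rcases h with ⟨h | h, h'⟩ | ⟨h | h, h'⟩
      · exact ⟨false, .inl ⟨h, hlarge s (h ▸ hrs) (by tauto)⟩⟩
      · exact ⟨false, .inr ⟨h, hlarge r (h ▸ hrs.symm) (by tauto)⟩⟩
      · exact ⟨true, .inl ⟨h, hlarge s (by tauto) (h ▸ hrs)⟩⟩
      · exact ⟨true, .inr ⟨h, hlarge r (by tauto) (h ▸ hrs.symm)⟩⟩
    obtain ⟨a, ⟨rfl, hs⟩ | ⟨rfl, hr⟩⟩ := key
    · exact ⟨(a, ⟨s, hs⟩), rfl⟩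
    · exact ⟨(a, ⟨r, hr⟩), Subtype.ext (Finset.pair_comm _ _)⟩
  · rintro ⟨⟨a, k⟩, rfl⟩
    rw [hx, Jgrid, card_inter_pair_eq_one_iff hne]
    cases a <;> simp [Jbase_inj, Jbase_ne]

theorem card_Jgrid_inter_eq_one_iff {n : ℕ} {hn : 2 ≤ n} {v w : Bool × JIndex n} :
    ((Jgrid n hn v).1 ∩ (Jgrid n hn w).1).card = 1 ↔ ¬(v.1 = w.1 ↔ v.2 = w.2) := by
  simp [Jgrid, card_inter_pair_eq_one_iff (Jbase_ne _ _), Jbase_inj, Jbase_ne,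
    (Jbase_ne _ _).symm, Subtype.ext_iff]

theorem Jgrid_inter_eq_empty_iff {n : ℕ} {hn : 2 ≤ n} {v w : Bool × JIndex n} :
    (Jgrid n hn v).1 ∩ (Jgrid n hn w).1 = ∅ ↔ v.1 ≠ w.1 ∧ v.2 ≠ w.2 := by
  simp [Jgrid, inter_pair_eq_empty_iff, Jbase_inj, Jbase_ne, (Jbase_ne _ _).symm, Subtype.ext_iff]

theorem JM_eq (R : Type*) [Zero R] [One R] (n : ℕ) (hn : 2 ≤ n) (y z : JPoint n) :
    JM R n hn y z = if ∃ (a : Bool) (k : JIndex n), y = Jgrid n hn (a, k) ∧ z = Jgrid n hn (!a, k)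
      then 1 else 0 := by
  simp only [JM, Matrix.of_apply]
  congr 1
  simp only [Bool.exists_bool, Subtype.exists, Jgrid, Subtype.ext_iff, Jbase, eq_iff_iff]
  grind

theorem JM_Jgrid (R : Type*) [Zero R] [One R] (n : ℕ) (hn : 2 ≤ n) (v w : Bool × JIndex n) :
    JM R n hn (Jgrid n hn v) (Jgrid n hn w) = if v.1 ≠ w.1 ∧ v.2 = w.2 then 1 else 0 := by
  rw [JM_eq]
  congr 1
  obtain ⟨a, i⟩ := v
  obtain ⟨b, j⟩ := w
  simp only [(Jgrid_injective n hn).eq_iff, Prod.mk.injEq, eq_iff_iff]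
  cases a <;> cases b <;> simp [eq_comm]

theorem JE_one_mul_mul_apply (R : Type*) [Semiring R] (n : ℕ) (hn : 2 ≤ n)
    (A : Matrix (JPoint n) (JPoint n) R) (y z : JPoint n) [Decidable (y ∈ Set.range (Jgrid n hn))]
    [Decidable (z ∈ Set.range (Jgrid n hn))] :
    (JE R n hn 1 * A * JE R n hn 1) y z =
      if y ∈ Set.range (Jgrid n hn) ∧ z ∈ Set.range (Jgrid n hn) then A y z else 0 := by
  simp only [JE, Matrix.mul_diagonal, Matrix.diagonal_mul, card_Jx_inter_eq_one_iff]
  split_ifs <;> simp_all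

theorem card_JIndex {n : ℕ} (hn : 2 < n) : (Fintype.card (JIndex n) : ℤ) = n - 2 := by
  rw [Fintype.card_of_subtype (Finset.Ici (⟨2, hn⟩ : Fin n)) (by simp [Fin.le_def]), Fin.card_Ici]
  push_cast [hn.le]
  rfl

theorem sum_rook_mul_rook {ι : Type*} [Fintype ι] [DecidableEq ι] (v w : Bool × ι) :
    (∑ u : Bool × ι, (if ¬(v.1 = u.1 ↔ v.2 = u.2) then (1 : ℤ) else 0) *
        (if ¬(u.1 = w.1 ↔ u.2 = w.2) then 1 else 0)) =
      Fintype.card ι * (if v = w then 1 else 0) +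
      (Fintype.card ι - 2) * (if ¬(v.1 = w.1 ↔ v.2 = w.2) then 1 else 0) +
      2 * (if v.1 ≠ w.1 ∧ v.2 ≠ w.2 then 1 else 0) -
      (Fintype.card ι - 2) * (if v.1 ≠ w.1 ∧ v.2 = w.2 then 1 else 0) := by
  have hxor (p q : Prop) [Decidable p] [Decidable q] : (if ¬(p ↔ q) then (1 : ℤ) else 0) =
      (if p then 1 else 0) + (if q then 1 else 0) -
        2 * ((if p then 1 else 0) * (if q then 1 else 0)) := by
    by_cases p <;> by_cases q <;> simp [*]
  obtain ⟨a, i⟩ := v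
  obtain ⟨b, j⟩ := w
  simp only [Fintype.sum_prod_type, Fintype.sum_bool, hxor]
  cases a <;> cases b <;> by_cases hij : i = j <;>
    simp [mul_sub, sub_mul, mul_add, add_mul, Finset.sum_sub_distrib, Finset.sum_add_distrib, hij] <;>
    ring

/-- **Identity.** In `M_X(ℤ)` for `J(n,2)` (`n ≥ 5`), `x = {1,2}`:
`(E₁*σ₁E₁*)² = (n−2)·E₁*σ₀E₁* + (n−4)·E₁*σ₁E₁* + 2·E₁*σ₂E₁* − (n−4)·M`. -/
theorem johnson_E1s1E1_sq (n : ℕ) (hn : 5 ≤ n) :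
    (JE ℤ n (by omega) 1 * Jσ ℤ n 1 * JE ℤ n (by omega) 1) *
        (JE ℤ n (by omega) 1 * Jσ ℤ n 1 * JE ℤ n (by omega) 1) =
      ((n : ℤ) - 2) • (JE ℤ n (by omega) 1 * Jσ ℤ n 0 * JE ℤ n (by omega) 1) +
      ((n : ℤ) - 4) • (JE ℤ n (by omega) 1 * Jσ ℤ n 1 * JE ℤ n (by omega) 1) +
      (2 : ℤ) • (JE ℤ n (by omega) 1 * Jσ ℤ n 2 * JE ℤ n (by omega) 1) -
      ((n : ℤ) - 4) • JM ℤ n (by omega) := by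
  classical
  have h2 : 2 ≤ n := by omega
  ext y z
  rw [Matrix.mul_apply]
  simp only [Matrix.sub_apply, Matrix.add_apply, Matrix.smul_apply, smul_eq_mul,
    JE_one_mul_mul_apply]
  by_cases hyz : y ∈ Set.range (Jgrid n h2) ∧ z ∈ Set.range (Jgrid n h2)
  · obtain ⟨⟨v, rfl⟩, ⟨w, rfl⟩⟩ := hyz
    rw [← Fintype.sum_of_injective (Jgrid n h2) (Jgrid_injective n h2) _ _
      (fun u hu => by simp [hu]) (fun u => rfl)]
    have key := sum_rook_mul_rook v w
    rw [card_JIndex (by omega : 2 < n)] at key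
    simp only [Set.mem_range_self, and_self, if_true, JM_Jgrid, Jσ, Matrix.of_apply,
      card_Jgrid_inter_eq_one_iff, Jgrid_inter_eq_empty_iff, (Jgrid_injective n h2).eq_iff,
      one_ne_zero, if_false, show (2 : Fin 3) ≠ 0 by decide, show (2 : Fin 3) ≠ 1 by decide]
    rw [key]
    ring
  · have hM : JM ℤ n h2 y z = 0 := by
      rw [JM_eq, if_neg]
      rintro ⟨a, k, rfl, rfl⟩
      exact hyz ⟨⟨_, rfl⟩, ⟨_, rfl⟩⟩
    rw [Finset.sum_eq_zero fun u _ => ?_]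
    · simp only [if_neg hyz, hM, mul_zero, add_zero, sub_zero]
    · by_cases hy : y ∈ Set.range (Jgrid n h2)
      · have hz : z ∉ Set.range (Jgrid n h2) := fun hz => hyz ⟨hy, hz⟩
        simp [hz]
      · simp [hy]
end

section
/- Let n ≥ 5 and let (X,S) be the Johnson scheme J(n,2) with fixed point x = {1,2}. Then in M_X(ℤ) the following identity holds: (E₁*σ₂E₁*)·(E₁*σ₂E₁*) = (n−3)·E₁*σ₀E₁* + (n−4)·E₁*σ₁E₁* − (n−4)·M. -/
open Matrix

/-- The point `{1,k}` (for `a = true`) or `{2,k}` (for `a = false`), with `k ≥ 3`. -/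
def crossPoint {m : ℕ} (p : Bool × Fin m) : JPoint (m + 2) :=
  ⟨{bif p.1 then 0 else 1, p.2.succ.succ},
    Finset.card_pair (by cases p.1 <;> simp [Fin.ext_iff])⟩

lemma mem_crossPoint {m : ℕ} (p : Bool × Fin m) (c : Fin (m + 2)) :
    c ∈ (crossPoint p).1 ↔ c = (bif p.1 then 0 else 1) ∨ c = p.2.succ.succ := by
  simp [crossPoint]

lemma crossPoint_injective {m : ℕ} :
    Function.Injective (crossPoint : Bool × Fin m → JPoint (m + 2)) := by
  rintro ⟨a, k⟩ ⟨b, l⟩ h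
  have h0 : ∀ c, c ∈ (crossPoint (a, k)).1 ↔ c ∈ (crossPoint (b, l)).1 := by simp [h]
  simp only [mem_crossPoint] at h0
  have h1 := h0 0
  have h2 := h0 k.succ.succ
  clear h h0
  cases a <;> cases b <;> simp [Fin.ext_iff] at h1 h2 ⊢ <;> omega

lemma crossPoint_inter_eq_empty {m : ℕ} (p q : Bool × Fin m) :
    (crossPoint p).1 ∩ (crossPoint q).1 = ∅ ↔ p.1 ≠ q.1 ∧ p.2 ≠ q.2 := by
  obtain ⟨a, k⟩ := p
  obtain ⟨b, l⟩ := q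
  rw [← Finset.disjoint_iff_inter_eq_empty]
  cases a <;> cases b <;> simp [crossPoint, Fin.ext_iff, eq_comm]

lemma card_crossPoint_inter_eq_one {m : ℕ} (p q : Bool × Fin m) :
    ((crossPoint p).1 ∩ (crossPoint q).1).card = 1 ↔
      p.1 = q.1 ∧ p.2 ≠ q.2 ∨ p.1 ≠ q.1 ∧ p.2 = q.2 := by
  have h0 := crossPoint_inter_eq_empty p q
  have h2 : ((crossPoint p).1 ∩ (crossPoint q).1).card = 2 ↔ p = q := by
    constructor
    · intro h
      have hp := Finset.eq_of_subset_of_card_le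
        (Finset.inter_subset_left (s₁ := (crossPoint p).1) (s₂ := (crossPoint q).1))
        (by rw [h, (crossPoint p).2])
      have hq := Finset.eq_of_subset_of_card_le
        (Finset.inter_subset_right (s₁ := (crossPoint p).1) (s₂ := (crossPoint q).1))
        (by rw [h, (crossPoint q).2])
      exact crossPoint_injective (Subtype.ext (hp.symm.trans hq))
    · rintro rfl
      rw [Finset.inter_self, (crossPoint p).2]
  have hle : ((crossPoint p).1 ∩ (crossPoint q).1).card ≤ 2 :=
    (Finset.card_le_card Finset.inter_subset_left).trans_eq (crossPoint p).2
  rw [← Finset.card_eq_zero] at h0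
  have h1 : ((crossPoint p).1 ∩ (crossPoint q).1).card = 1 ↔
      ¬ ((crossPoint p).1 ∩ (crossPoint q).1).card = 0 ∧
      ¬ ((crossPoint p).1 ∩ (crossPoint q).1).card = 2 := by omega
  rw [h1, h0, h2, Prod.ext_iff]
  tauto

lemma card_Jx_inter_eq_one_iff_s15 {m : ℕ} (y : JPoint (m + 2)) :
    ((Jx (m + 2) (by omega)).1 ∩ y.1).card = 1 ↔ y ∈ Set.range crossPoint := by
  constructor
  · obtain ⟨y, hy⟩ := y
    obtain ⟨u, v, huv, rfl⟩ := Finset.card_eq_two.1 hy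
    intro h
    induction u using Fin.cases with
    | zero =>
      induction v using Fin.cases with
      | zero => exact absurd rfl huv
      | succ v =>
        induction v using Fin.cases with
        | zero => exact absurd h (by simp [Jx])
        | succ v => exact ⟨(true, v), by simp [crossPoint]⟩
    | succ u =>
      induction u using Fin.cases with
      | zero =>
        induction v using Fin.cases with
        | zero => exact absurd h (by simp [Jx, Finset.pair_comm])
        | succ v =>
          induction v using Fin.cases with
          | zero => exact absurd rfl huv
          | succ v => exact ⟨(false, v), by simp [crossPoint]⟩
      | succ u =>
        induction v using Fin.cases with
        | zero => exact ⟨(true, u), by simp [crossPoint, Finset.pair_comm]⟩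
        | succ v =>
          induction v using Fin.cases with
          | zero => exact ⟨(false, u), by simp [crossPoint, Finset.pair_comm]⟩
          | succ v =>
            have h0 : (Jx (m + 2) (by omega)).1 ∩ {u.succ.succ, v.succ.succ} = ∅ := by
              rw [← Finset.disjoint_iff_inter_eq_empty]
              simp [Jx, Fin.ext_iff]
            exact absurd h (by simp [h0])
  · rintro ⟨⟨a, k⟩, rfl⟩
    rw [Finset.card_eq_one]
    refine ⟨bif a then 0 else 1, ?_⟩
    ext c
    rw [Finset.mem_inter, mem_crossPoint]
    cases a <;> simp only [Jx, Finset.mem_insert, Finset.mem_singleton, Fin.ext_iff, cond_true,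
      cond_false, Fin.val_succ, Fin.val_zero, Fin.val_one] <;> omega

open Classical in
lemma JE_one_mul_mul_JE_one_apply {m : ℕ} (A : Matrix (JPoint (m + 2)) (JPoint (m + 2)) ℤ)
    (y z : JPoint (m + 2)) :
    (JE ℤ (m + 2) (by omega) 1 * A * JE ℤ (m + 2) (by omega) 1) y z =
      if y ∈ Set.range crossPoint ∧ z ∈ Set.range crossPoint then A y z else 0 := by
  simp only [JE, Matrix.mul_diagonal, Matrix.diagonal_mul, card_Jx_inter_eq_one_iff_s15]
  by_cases hy : y ∈ Set.range crossPoint <;> by_cases hz : z ∈ Set.range crossPoint <;>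
    simp [hy, hz]

lemma JM_apply_of_notMem_range {m : ℕ} {y z : JPoint (m + 2)}
    (h : ¬ (y ∈ Set.range crossPoint ∧ z ∈ Set.range crossPoint)) :
    JM ℤ (m + 2) (by omega) y z = 0 := by
  rw [JM, Matrix.of_apply, if_neg]
  rintro ⟨c, hc, hyz⟩
  obtain ⟨k, rfl⟩ : ∃ k : Fin m, c = k.succ.succ :=
    ⟨⟨c.val - 2, by omega⟩, by simp [Fin.ext_iff]; omega⟩
  rcases hyz with ⟨hy, hz⟩ | ⟨hy, hz⟩
  · exact h ⟨⟨(true, k), Subtype.ext hy.symm⟩, ⟨(false, k), Subtype.ext hz.symm⟩⟩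
  · exact h ⟨⟨(false, k), Subtype.ext hy.symm⟩, ⟨(true, k), Subtype.ext hz.symm⟩⟩

lemma JM_crossPoint {m : ℕ} (p q : Bool × Fin m) :
    JM ℤ (m + 2) (by omega) (crossPoint p) (crossPoint q) =
      if p.1 ≠ q.1 ∧ p.2 = q.2 then 1 else 0 := by
  rw [JM, Matrix.of_apply]
  refine if_congr ⟨?_, ?_⟩ rfl rfl
  · rintro ⟨c, hc, hyz⟩
    obtain ⟨k, rfl⟩ : ∃ k : Fin m, c = k.succ.succ :=
      ⟨⟨c.val - 2, by omega⟩, by simp [Fin.ext_iff]; omega⟩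
    rcases hyz with ⟨hy, hz⟩ | ⟨hy, hz⟩
    · rw [crossPoint_injective (a₁ := p) (a₂ := (true, k)) (Subtype.ext hy),
        crossPoint_injective (a₁ := q) (a₂ := (false, k)) (Subtype.ext hz)]
      simp
    · rw [crossPoint_injective (a₁ := p) (a₂ := (false, k)) (Subtype.ext hy),
        crossPoint_injective (a₁ := q) (a₂ := (true, k)) (Subtype.ext hz)]
      simp
  · obtain ⟨a, k⟩ := p
    obtain ⟨b, l⟩ := q
    rintro ⟨hab, rfl : k = l⟩
    refine ⟨k.succ.succ, by simp, ?_⟩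
    cases a <;> cases b
    · exact absurd rfl hab
    · exact Or.inr ⟨rfl, rfl⟩
    · exact Or.inl ⟨rfl, rfl⟩
    · exact absurd rfl hab

lemma sum_ne_and_ne {m : ℕ} (i j : Fin m) :
    (∑ k : Fin m, if i ≠ k ∧ k ≠ j then (1 : ℤ) else 0) =
      if i = j then (m : ℤ) - 1 else (m : ℤ) - 2 := by
  have h : (Finset.univ.filter fun k : Fin m => i ≠ k ∧ k ≠ j) = ({i, j} : Finset (Fin m))ᶜ := by
    ext k
    simp [eq_comm]
  have hc := Finset.card_add_card_compl ({i, j} : Finset (Fin m))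
  rw [Finset.sum_boole, h]
  rw [Fintype.card_fin] at hc
  split_ifs with hij
  · subst hij
    rw [Finset.pair_eq_singleton, Finset.card_singleton] at hc
    rw [Finset.pair_eq_singleton]
    omega
  · rw [Finset.card_pair hij] at hc
    omega

/-- **Identity.** In `M_X(ℤ)` for `J(n,2)` (`n ≥ 5`), `x = {1,2}`:
`(E₁*σ₂E₁*)² = (n−3)·E₁*σ₀E₁* + (n−4)·E₁*σ₁E₁* − (n−4)·M`. -/
theorem johnson_E1s2E1_sq (n : ℕ) (hn : 5 ≤ n) :
    (JE ℤ n (by omega) 1 * Jσ ℤ n 2 * JE ℤ n (by omega) 1) *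
        (JE ℤ n (by omega) 1 * Jσ ℤ n 2 * JE ℤ n (by omega) 1) =
      ((n : ℤ) - 3) • (JE ℤ n (by omega) 1 * Jσ ℤ n 0 * JE ℤ n (by omega) 1) +
      ((n : ℤ) - 4) • (JE ℤ n (by omega) 1 * Jσ ℤ n 1 * JE ℤ n (by omega) 1) -
      ((n : ℤ) - 4) • JM ℤ n (by omega) := by
  classical
  obtain ⟨m, rfl⟩ : ∃ m, n = m + 2 := ⟨n - 2, by omega⟩
  ext y z
  rw [Matrix.sub_apply, Matrix.add_apply, Matrix.smul_apply, Matrix.smul_apply, Matrix.smul_apply,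
    Matrix.mul_apply]
  simp only [JE_one_mul_mul_JE_one_apply]
  by_cases h : y ∈ Set.range crossPoint ∧ z ∈ Set.range crossPoint
  · obtain ⟨⟨⟨a, i⟩, rfl⟩, ⟨⟨b, j⟩, rfl⟩⟩ := h
    rw [← Fintype.sum_of_injective crossPoint crossPoint_injective
      (fun w => (if a ≠ w.1 ∧ i ≠ w.2 then (1 : ℤ) else 0) *
        if w.1 ≠ b ∧ w.2 ≠ j then (1 : ℤ) else 0) _
      (fun w hw => by simp only [hw, and_false, if_false, zero_mul])
      (fun w => by simp [Jσ, crossPoint_inter_eq_empty])]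
    have hs := sum_ne_and_ne i j
    simp only [← ite_and, mul_ite, mul_one, mul_zero] at hs ⊢
    rw [Fintype.sum_prod_type, Fintype.sum_bool, JM_crossPoint]
    simp only [Jσ, Matrix.of_apply, card_crossPoint_inter_eq_one, crossPoint_injective.eq_iff]
    by_cases hij : i = j <;> cases a <;> cases b <;>
      simp_all [and_comm] <;> ring
  · rw [JM_apply_of_notMem_range h, if_neg h, if_neg h, Finset.sum_eq_zero]
    · simp
    · intro w _
      by_cases hy : y ∈ Set.range crossPoint
      · have hz : z ∉ Set.range crossPoint := fun hz => h ⟨hy, hz⟩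
        simp only [hz, and_false, if_false, mul_zero]
      · simp only [hy, false_and, if_false, zero_mul]
end
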